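/- Let N be a nonnegative integer, let η be real with |η| < 1/(2(N+1)), and let a = (a₁,a₂,a₃,a₄) ∈ ℂ⁴ with a₁+a₂+a₃+a₄ = 0. Then for all f, g ∈ Θ_N one has ⟨Δ(a)f, g⟩ = −⟨f, σ(Δ(−ā)(σg))⟩, where −ā = (−conj(a₁), −conj(a₂), −conj(a₃), −conj(a₄)); that is, the adjoint of Δ(a) with respect to the Sklyanin pairing is −σ∘Δ(−ā)∘σ. -/

import Mathlib

noncomputable section
open Complex MeasureTheory

def cπ : ℂ := Real.pi

/-- Jacobi's first theta function θ₁(x|τ). -/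
def θf (τ x : ℂ) : ℂ :=
  I * ∑' n : ℤ, (-1 : ℂ) ^ n *
    Complex.exp (cπ * I * τ * ((n : ℂ) - 1/2)^2 + cπ * I * (2*(n : ℂ) - 1) * x)

/-- The space Θ_N of even theta functions of order 2N. -/
def ThetaSp (τ : ℂ) (N : ℕ) (f : ℂ → ℂ) : Prop :=
  Differentiable ℂ f ∧ (∀ x, f (x + 1) = f x) ∧
  (∀ x, f (x + τ) = Complex.exp (-2*cπ*I*N*(2*x + τ)) * f x) ∧
  (∀ x, f (-x) = f x)

/-- Sklyanin's weight function M(u,v). -/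
def Mw (τ η : ℂ) (N : ℕ) (u v : ℂ) : ℂ :=
  θf τ (2*u) * θf τ (2*v) /
    (Complex.exp (2*cπ*I*u*(N+2)) *
      ∏ k ∈ Finset.range (N+2),
        (θf τ (u + v + (2*(k:ℂ) - N - 1)*η + 1/2 + τ/2) *
         θf τ (u - v + (2*(k:ℂ) - N - 1)*η + 1/2 + τ/2)))

/-- Sklyanin's invariant pairing, with τ = t * I. -/
def pairing (τ η : ℂ) (t : ℝ) (N : ℕ) (f g : ℂ → ℂ) : ℂ :=
  ∫ y in (0:ℝ)..t, ∫ x in (0:ℝ)..(1:ℝ),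
    f (x + y*I) * (starRingEnd ℂ) (g (x + y*I)) *
      Mw τ η N (x + y*I) ((starRingEnd ℂ) (x + y*I))

/-- The numerator defining the difference operator Δ(a). -/
def ΔRHS (τ η : ℂ) (N : ℕ) (a₁ a₂ a₃ a₄ : ℂ) (f : ℂ → ℂ) (x : ℂ) : ℂ :=
  θf τ (x + a₁ - N*η/2) * θf τ (x + a₂ - N*η/2) * θf τ (x + a₃ - N*η/2) *
    θf τ (x + a₄ - N*η/2) * f (x + η)
  - θf τ (x - a₁ + N*η/2) * θf τ (x - a₂ + N*η/2) * θf τ (x - a₃ + N*η/2) *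
    θf τ (x - a₄ + N*η/2) * f (x - η)

/-- The involution σ on Θ_N. -/
def σop (τ : ℂ) (N : ℕ) (f : ℂ → ℂ) (x : ℂ) : ℂ :=
  Complex.exp (2*cπ*I*N*(1/4 + τ/4 + x)) * f (x + 1/2 + τ/2)

/-- q-Pochhammer infinite product (a;p)_∞. -/
def qPoch (a p : ℂ) : ℂ := ∏' j : ℕ, (1 - a * p^j)

/-- The constant C of Theorem 3.2. -/
def Cconst (τ η : ℂ) (N : ℕ) : ℂ :=
  2*η * Complex.exp (2*cπ*I*τ*(3/8)) /
    (θf τ (2*(N+1)*η) *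
      (qPoch (Complex.exp (2*cπ*I*τ)) (Complex.exp (2*cπ*I*τ)))^3)

/-- The kernel K(u,w). -/
def Kk (τ η : ℂ) (N : ℕ) (u w : ℂ) : ℂ :=
  Complex.exp (2*cπ*I*u*(N:ℂ)) *
  ∏ k ∈ Finset.range N,
    (θf τ (u + w + (2*(k:ℂ) - N + 1)*η + 1/2 + τ/2) *
     θf τ (u - w + (2*(k:ℂ) - N + 1)*η + 1/2 + τ/2))

/-- The basis functions e_k^N(x;a,b). -/
def ekN (τ η : ℂ) (N k : ℕ) (a b : ℂ) (x : ℂ) : ℂ :=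
  (∏ j ∈ Finset.range k, (θf τ (a + x + 2*(j:ℂ)*η) * θf τ (a - x + 2*(j:ℂ)*η))) *
  (∏ j ∈ Finset.range (N - k), (θf τ (b + x + 2*(j:ℂ)*η) * θf τ (b - x + 2*(j:ℂ)*η)))

/-- Elliptic number [x] = θ(2ηx). -/
def ell (τ η x : ℂ) : ℂ := θf τ (2*η*x)

/-- Elliptic shifted factorial [x]_k. -/
def ellFac (τ η x : ℂ) (k : ℕ) : ℂ := ∏ j ∈ Finset.range k, ell τ η (x + j)



lemma sk_cpi : cπ = (Real.pi : ℂ) := rfl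

lemma sk_tau_im {t : ℝ} (ht : 0 < t) {τ : ℂ} (hτ : τ = t * I) : 0 < τ.im := by
  subst hτ; simpa using ht

lemma sk_theta_eq (τ x : ℂ) :
    θf τ x = I * exp (cπ * I * τ / 4 - cπ * I * x) * jacobiTheta₂ (x + 1/2 - τ/2) τ := by
  unfold θf jacobiTheta₂
  rw [mul_assoc I]
  congr 1
  rw [← tsum_mul_left]
  apply tsum_congr
  intro n
  rw [jacobiTheta₂_term, ← exp_add]
  have : (-1 : ℂ) ^ n = exp (cπ * I * n) := by
    rw [sk_cpi, mul_comm, exp_int_mul, exp_pi_mul_I]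
  rw [this, ← exp_add]
  congr 1
  simp only [sk_cpi]
  ring

lemma sk_theta_diff {τ : ℂ} (h : 0 < τ.im) : Differentiable ℂ (θf τ) := by
  have : θf τ = fun x => I * exp (cπ * I * τ / 4 - cπ * I * x) * jacobiTheta₂ (x + 1/2 - τ/2) τ := by
    ext x; exact sk_theta_eq τ x
  rw [this]
  intro x
  have h2 := (differentiableAt_jacobiTheta₂_fst (x + 1/2 - τ/2) h)
  have h3 : DifferentiableAt ℂ (fun x => jacobiTheta₂ (x + 1/2 - τ/2) τ) x :=
    DifferentiableAt.comp x (f := fun x : ℂ => x + 1/2 - τ/2) h2 (by fun_prop)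
  exact DifferentiableAt.mul (by fun_prop) h3

lemma sk_exp_pi : exp (cπ * I) = -1 := by rw [sk_cpi, exp_pi_mul_I]

lemma sk_neg_exp (a : ℂ) : - exp a = exp (a + cπ * I) := by
  rw [exp_add, sk_exp_pi]; ring

lemma sk_neg_exp' (a : ℂ) : - exp a = exp (a - cπ * I) := by
  rw [exp_sub, sk_exp_pi]; ring

lemma sk_exp_int (n : ℤ) : exp (2 * cπ * I * n) = 1 := by
  rw [sk_cpi, mul_comm]; exact exp_int_mul_two_pi_mul_I n

lemma sk_theta_add_one (τ x : ℂ) : θf τ (x + 1) = - θf τ x := by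
  rw [sk_theta_eq, sk_theta_eq, show x + 1 + 1/2 - τ/2 = (x + 1/2 - τ/2) + 1 by ring,
    jacobiTheta₂_add_left, show cπ * I * τ / 4 - cπ * I * (x+1) =
      (cπ * I * τ / 4 - cπ * I * x) - cπ * I by ring, exp_sub, sk_exp_pi]
  ring

lemma sk_theta_add_tau (τ x : ℂ) :
    θf τ (x + τ) = - exp (- (cπ * I * τ) - 2 * cπ * I * x) * θf τ x := by
  rw [sk_theta_eq, sk_theta_eq, show x + τ + 1/2 - τ/2 = (x + 1/2 - τ/2) + τ by ring,
    jacobiTheta₂_add_left']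
  have : exp (cπ * I * τ / 4 - cπ * I * (x + τ)) * exp (-↑Real.pi * I * (τ + 2 * (x + 1/2 - τ/2)))
     = - exp (- (cπ * I * τ) - 2 * cπ * I * x) * exp (cπ * I * τ / 4 - cπ * I * x) := by
    rw [← exp_add, neg_mul (exp _), ← exp_add, sk_neg_exp']
    congr 1
    simp only [sk_cpi]; ring
  linear_combination I * jacobiTheta₂ (x + 1/2 - τ/2) τ * this

lemma sk_theta_neg (τ x : ℂ) : θf τ (-x) = - θf τ x := by
  rw [sk_theta_eq, sk_theta_eq, ← jacobiTheta₂_neg_left,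
    show -(-x + 1/2 - τ/2) = (x - 1/2 - τ/2) + τ by ring, jacobiTheta₂_add_left',
    show x + 1/2 - τ/2 = (x - 1/2 - τ/2) + 1 by ring, jacobiTheta₂_add_left]
  have : exp (cπ * I * τ / 4 - cπ * I * (-x)) * exp (-↑Real.pi * I * (τ + 2 * (x - 1/2 - τ/2)))
     = - exp (cπ * I * τ / 4 - cπ * I * x) := by
    rw [← exp_add, sk_neg_exp]
    congr 1
    simp only [sk_cpi]; ring
  linear_combination I * jacobiTheta₂ (x - 1/2 - τ/2) τ * this

lemma sk_theta_zero (τ : ℂ) : θf τ 0 = 0 := by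
  have := sk_theta_neg τ 0
  rw [neg_zero] at this
  linear_combination this / 2

lemma sk_conj_tau {t : ℝ} {τ : ℂ} (hτ : τ = t * I) : (starRingEnd ℂ) τ = - τ := by
  subst hτ; simp

lemma sk_conj_pi : (starRingEnd ℂ) cπ = cπ := by rw [sk_cpi, conj_ofReal]

lemma sk_theta_conj {t : ℝ} {τ : ℂ} (hτ : τ = t * I) (x : ℂ) :
    (starRingEnd ℂ) (θf τ x) = θf τ ((starRingEnd ℂ) x) := by
  rw [sk_theta_eq, map_mul, map_mul, jacobiTheta₂_conj, ← exp_conj]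
  simp only [map_sub, map_mul, map_add, map_div₀, map_one, conj_I, sk_conj_tau hτ, sk_conj_pi,
    map_ofNat, neg_neg]
  rw [← neg_neg ((starRingEnd ℂ) x), sk_theta_neg, sk_theta_eq, ← jacobiTheta₂_neg_left,
    ← jacobiTheta₂_add_left _ τ]
  ring_nf

/-- nonvanishing somewhere -/
lemma sk_theta_ne {t : ℝ} (ht : 0 < t) {τ : ℂ} (hτ : τ = t * I) : ∃ x, θf τ x ≠ 0 := by
  refine ⟨τ/2 - 1/2, ?_⟩
  rw [sk_theta_eq]
  refine mul_ne_zero (mul_ne_zero I_ne_zero (exp_ne_zero _)) ?_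
  rw [show τ/2 - 1/2 + 1/2 - τ/2 = 0 by ring]
  have hs := hasSum_jacobiTheta₂_term 0 (sk_tau_im ht hτ)
  have hterm : ∀ n : ℤ, jacobiTheta₂_term n 0 τ = ((Real.exp (-Real.pi * n^2 * t) : ℝ) : ℂ) := by
    intro n
    rw [jacobiTheta₂_term, ofReal_exp]
    congr 1
    subst hτ
    push_cast
    linear_combination (Real.pi * n^2 * t : ℂ) * I_mul_I
  simp_rw [hterm] at hs
  have hre := Complex.hasSum_re hs
  simp only [ofReal_re] at hre
  have hpos : 0 < (jacobiTheta₂ 0 τ).re := by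
    rw [← hre.tsum_eq]
    exact hre.summable.tsum_pos (fun _ => (Real.exp_pos _).le) 0 (Real.exp_pos _)
  intro h
  rw [h] at hpos
  simp at hpos

/-- division lemma -/
lemma sk_div {φ P : ℂ → ℂ} (hφ : Differentiable ℂ φ) (hP : Differentiable ℂ P)
    (h : ∀ z, P z = 0 → deriv P z ≠ 0 ∧ φ z = 0) :
    ∃ ψ : ℂ → ℂ, Differentiable ℂ ψ ∧ ∀ z, φ z = P z * ψ z := by
  classical
  refine ⟨fun z => if P z = 0 then deriv φ z / deriv P z else φ z / P z, ?_, ?_⟩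
  · intro z
    by_cases hz : P z = 0
    · obtain ⟨hd, hφz⟩ := h z hz
      have e1 : Differentiable ℂ (dslope φ z) := by
        rw [← differentiableOn_univ, Complex.differentiableOn_dslope Filter.univ_mem]
        exact hφ.differentiableOn
      have e2 : Differentiable ℂ (dslope P z) := by
        rw [← differentiableOn_univ, Complex.differentiableOn_dslope Filter.univ_mem]
        exact hP.differentiableOn
      have hne : dslope P z z ≠ 0 := by rw [dslope_same]; exact hd
      have key : DifferentiableAt ℂ (fun w => dslope φ z w / dslope P z w) z :=
        (e1 z).div (e2 z) hne
      refine key.congr_of_eventuallyEq ?_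
      have hev : ∀ᶠ w in nhds z, dslope P z w ≠ 0 :=
        (e2 z).continuousAt.eventually_ne hne
      filter_upwards [hev] with w hw
      by_cases hwz : w = z
      · subst hwz
        simp [hz, dslope_same]
      · have h1 : φ w = (w - z) * dslope φ z w := by
          have := sub_smul_dslope φ z w
          rw [hφz, sub_zero, smul_eq_mul] at this
          exact this.symm
        have h2 : P w = (w - z) * dslope P z w := by
          have := sub_smul_dslope P z w
          rw [hz, sub_zero, smul_eq_mul] at this
          exact this.symm
        have h3 : w - z ≠ 0 := sub_ne_zero.mpr hwz
        have h4 : P w ≠ 0 := by rw [h2]; exact mul_ne_zero h3 hw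
        simp only [h4, if_false]
        rw [h1, h2, mul_div_mul_left _ _ h3]
    · have hev : ∀ᶠ w in nhds z, P w ≠ 0 := (hP z).continuousAt.eventually_ne hz
      refine DifferentiableAt.congr_of_eventuallyEq ((hφ z).div (hP z) hz) ?_
      filter_upwards [hev] with w hw
      simp [hw]
  · intro z
    by_cases hz : P z = 0
    · simp [hz, (h z hz).2]
    · simp only [hz, if_false]
      field_simp

/-- invariance under the lattice -/
lemma sk_lat (τ : ℂ) (Pr : ℂ → Prop) (h1 : ∀ z, Pr (z + 1) ↔ Pr z) (h2 : ∀ z, Pr (z + τ) ↔ Pr z)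
    (m l : ℤ) (z : ℂ) : Pr (z + m + l * τ) ↔ Pr z := by
  have a1 : ∀ m : ℤ, ∀ z : ℂ, Pr (z + m) ↔ Pr z := by
    intro m
    induction m using Int.induction_on with
    | zero => intro z; simp
    | succ i ih =>
      intro z
      rw [← ih z, ← h1 (z + ((i : ℤ) : ℂ))]
      push_cast
      rw [add_assoc]
    | pred i ih =>
      intro z
      rw [← ih z, ← h1 (z + _)]
      push_cast
      ring_nf
  have a2 : ∀ m : ℤ, ∀ z : ℂ, Pr (z + m * τ) ↔ Pr z := by
    intro m
    induction m using Int.induction_on with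
    | zero => intro z; simp
    | succ i ih =>
      intro z
      rw [← ih z, ← h2 (z + ((i : ℤ) : ℂ) * τ)]
      push_cast
      ring_nf
    | pred i ih =>
      intro z
      rw [← ih z, ← h2 (z + _)]
      push_cast
      ring_nf
  rw [a2, a1]

lemma sk_elliptic_const {t : ℝ} (ht : 0 < t) {τ : ℂ} (hτ : τ = t * I) {φ : ℂ → ℂ}
    (hφ : Differentiable ℂ φ) (h1 : ∀ z, φ (z + 1) = φ z) (h2 : ∀ z, φ (z + τ) = φ z)
    (z w : ℂ) : φ z = φ w := by
  apply hφ.apply_eq_apply_of_bounded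
  have hK : IsCompact (Set.Icc (0:ℝ) 1 ×ℂ Set.Icc (0:ℝ) t) := isCompact_Icc.reProdIm isCompact_Icc
  refine ((hK.image hφ.continuous).isBounded).subset ?_
  rintro _ ⟨z, rfl⟩
  set l : ℤ := ⌊z.im / t⌋ with hl
  set m : ℤ := ⌊z.re⌋ with hm
  refine ⟨z + (-m : ℤ) + (-l : ℤ) * τ, ?_, ?_⟩
  · rw [mem_reProdIm]
    subst hτ
    constructor
    · simp
      constructor
      · have := Int.floor_le z.re; linarith
      · have := Int.lt_floor_add_one z.re; linarith
    · simp
      have e1 := Int.floor_le (z.im / t)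
      have e2 := Int.lt_floor_add_one (z.im / t)
      rw [← hl] at e1 e2
      rw [le_div_iff₀ ht] at e1
      rw [div_lt_iff₀ ht] at e2
      constructor
      · linarith
      · linarith
  · exact (sk_lat τ (fun w => φ w = φ z) (by intro z; rw [h1]) (by intro z; rw [h2]) (-m) (-l) z).2 rfl

/-- the auxiliary product -/
def skq (p w : ℂ) : ℂ := ∏' j : ℕ, (1 + (- (p ^ (j+1) * w)))

lemma sk_summ {p : ℂ} (hp : ‖p‖ < 1) (w : ℂ) : Summable fun j : ℕ => ‖-(p ^ (j+1) * w)‖ := by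
  have := ((summable_nat_add_iff 1).mpr (summable_geometric_of_lt_one (norm_nonneg p) hp)).mul_right ‖w‖
  simpa using this

lemma skq_diff {p : ℂ} (hp : ‖p‖ < 1) : Differentiable ℂ (skq p) := by
  rw [← differentiableOn_univ]
  have : HasProdLocallyUniformlyOn (fun (j : ℕ) (w : ℂ) => 1 + (-(p ^ (j+1) * w))) (skq p) Set.univ := by
    apply hasProdLocallyUniformlyOn_of_forall_compact isOpen_univ
    intro K hK hcK
    obtain ⟨C, hC⟩ := hcK.isBounded.exists_norm_le
    have hs := ((summable_nat_add_iff 1).mpr (summable_geometric_of_lt_one (norm_nonneg p) hp)).mul_right C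
    refine hs.hasProdUniformlyOn_nat_one_add hcK (.of_forall fun n x hx ↦ ?_) (fun _ ↦ by fun_prop)
    simp only [norm_neg, norm_mul, norm_pow]
    exact mul_le_mul_of_nonneg_left (hC x hx) (by positivity)
  exact this.differentiableOn
    (.of_forall fun _ ↦ by simpa [Finset.prod_fn] using
      DifferentiableOn.finsetProd (fun _ _ ↦ by fun_prop)) isOpen_univ

lemma skq_ne {p : ℂ} (hp : ‖p‖ < 1) {w : ℂ} (h : ∀ j : ℕ, p ^ (j+1) * w ≠ 1) : skq p w ≠ 0 := by
  refine tprod_one_add_ne_zero_of_summable (f := fun j => -(p ^ (j+1) * w)) ?_ (sk_summ hp w)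
  intro i hi
  exact h i (by linear_combination -hi)

lemma skq_fe {p : ℂ} (hp : ‖p‖ < 1) (w : ℂ) : skq p w = (1 - p * w) * skq p (p * w) := by
  have hm : Multipliable fun j : ℕ => (1 + -(p ^ (j+1+1) * w)) :=
    multipliable_one_add_of_summable (by
      have := sk_summ hp (p * w)
      refine this.congr ?_
      intro j; ring_nf)
  unfold skq
  rw [tprod_eq_zero_mul' (f := fun j : ℕ => (1 + -(p ^ (j+1) * w))) hm]
  congr 1
  · ring
  · apply tprod_congr; intro j; ring

def skP (τ z : ℂ) : ℂ := (1 - exp (2 * cπ * I * z)) * (skq (exp (2 * cπ * I * τ)) (exp (2 * cπ * I * z)) *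
  skq (exp (2 * cπ * I * τ)) (exp (-(2 * cπ * I * z))))

section
variable {t : ℝ} {τ : ℂ}

lemma sk_p_lt (ht : 0 < t) (hτ : τ = t * I) : ‖exp (2 * cπ * I * τ)‖ < 1 := by
  rw [norm_exp]
  rw [Real.exp_lt_one_iff]
  subst hτ
  simp [sk_cpi]
  positivity

lemma skP_diff (ht : 0 < t) (hτ : τ = t * I) : Differentiable ℂ (skP τ) := by
  unfold skP
  have := skq_diff (sk_p_lt ht hτ)
  fun_prop

lemma skP_one (z : ℂ) : skP τ (z + 1) = skP τ z := by
  have : exp (2 * cπ * I * (z+1)) = exp (2 * cπ * I * z) := by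
    rw [mul_add, exp_add]
    have := sk_exp_int 1
    push_cast at this
    rw [this, mul_one]
  unfold skP
  simp only [exp_neg, this]

lemma skP_tau (ht : 0 < t) (hτ : τ = t * I) (z : ℂ) :
    skP τ (z + τ) = - exp (-(2 * cπ * I * z)) * skP τ z := by
  unfold skP
  rw [show 2 * cπ * I * (z + τ) = 2 * cπ * I * τ + 2 * cπ * I * z by ring, exp_add,
    skq_fe (sk_p_lt ht hτ) (exp (2 * cπ * I * z)),
    skq_fe (sk_p_lt ht hτ) (exp (-(2 * cπ * I * τ + 2 * cπ * I * z))), ← exp_add (2 * cπ * I * τ) (-_)]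
  rw [show 2 * cπ * I * τ + -(2 * cπ * I * τ + 2 * cπ * I * z) = -(2 * cπ * I * z) by ring]
  have : exp (-(2 * cπ * I * z)) * exp (2 * cπ * I * z) = 1 := by rw [← exp_add]; simp
  linear_combination (- skq (exp (2 * cπ * I * τ)) (exp (2 * cπ * I * τ) * exp (2 * cπ * I * z)) * 
    (1 - exp (2 * cπ * I * τ) * exp (2 * cπ * I * z)) *
    skq (exp (2 * cπ * I * τ)) (exp (-(2 * cπ * I * z)))) * this

lemma sk_exp_one {z : ℂ} (h : exp (2 * cπ * I * z) = 1) : ∃ m : ℤ, z = m := by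
  rw [exp_eq_one_iff] at h
  obtain ⟨n, hn⟩ := h
  refine ⟨n, ?_⟩
  have : (2 * cπ * I) ≠ 0 := by rw [sk_cpi]; exact two_pi_I_ne_zero
  apply mul_left_cancel₀ this
  rw [hn, sk_cpi]; ring

lemma skP_zero_imp (ht : 0 < t) (hτ : τ = t * I) {z : ℂ} (h : skP τ z = 0) :
    ∃ m l : ℤ, z = m + l * τ := by
  by_contra hcon
  push Not at hcon
  revert h
  unfold skP
  refine mul_ne_zero ?_ (mul_ne_zero (skq_ne (sk_p_lt ht hτ) ?_) (skq_ne (sk_p_lt ht hτ) ?_))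
  · intro h
    obtain ⟨m, hm⟩ := sk_exp_one (z := z) (by linear_combination -h)
    exact hcon m 0 (by simp [hm])
  · intro j h
    rw [← exp_nat_mul, ← exp_add] at h
    obtain ⟨m, hm⟩ := sk_exp_one (z := (j+1) * τ + z) (by
      refine Eq.trans (congrArg exp ?_) h; push_cast; ring)
    exact hcon m (-(j+1)) (by push_cast; linear_combination hm)
  · intro j h
    rw [← exp_nat_mul, ← exp_add] at h
    obtain ⟨m, hm⟩ := sk_exp_one (z := (j+1) * τ - z) (by
      refine Eq.trans (congrArg exp ?_) h; push_cast; ring)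
    exact hcon (-m) ((j+1)) (by push_cast; linear_combination -hm)

lemma skP_deriv (ht : 0 < t) (hτ : τ = t * I) {z : ℂ} (h : skP τ z = 0) : deriv (skP τ) z ≠ 0 := by
  have hd := skP_diff ht hτ
  have h0 : skP τ 0 = 0 ∧ deriv (skP τ) 0 ≠ 0 := by
    constructor
    · simp [skP]
    · have hq := skq_diff (sk_p_lt ht hτ)
      have e1 : HasDerivAt (fun z : ℂ => 1 - exp (2 * cπ * I * z)) (-(2 * cπ * I)) 0 := by
        have : HasDerivAt (fun z : ℂ => 2 * cπ * I * z) (2 * cπ * I) 0 := by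
          simpa using (hasDerivAt_id (0:ℂ)).const_mul (2 * cπ * I)
        simpa using this.cexp.const_sub 1
      have e2 : DifferentiableAt ℂ (fun z : ℂ => skq (exp (2 * cπ * I * τ)) (exp (2 * cπ * I * z)) *
          skq (exp (2 * cπ * I * τ)) (exp (-(2 * cπ * I * z)))) 0 := by fun_prop
      have e3 := (e1.mul e2.hasDerivAt).deriv
      have e4 : (skP τ) = ((fun z : ℂ => 1 - exp (2 * cπ * I * z)) * 
        fun z : ℂ => skq (exp (2 * cπ * I * τ)) (exp (2 * cπ * I * z)) *
          skq (exp (2 * cπ * I * τ)) (exp (-(2 * cπ * I * z)))) := by ext z; rfl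
      rw [e4, e3]
      have hne : skq (exp (2 * cπ * I * τ)) 1 ≠ 0 := by
        apply skq_ne (sk_p_lt ht hτ)
        intro j hj
        have h1 := sk_p_lt ht hτ
        have h2 : ‖exp (2 * cπ * I * τ)‖ ^ (j+1) < 1 := pow_lt_one₀ (norm_nonneg _) h1 (by simp)
        rw [mul_one] at hj
        rw [← norm_pow, hj] at h2
        simp at h2
      have : (2 * cπ * I) ≠ 0 := by rw [sk_cpi]; exact two_pi_I_ne_zero
      simp
      refine ⟨?_, hne⟩
      intro hh; exact this (by rw [hh]; simp)
  have hone : ∀ z, deriv (skP τ) (z + 1) = deriv (skP τ) z := by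
    intro z
    rw [← deriv_comp_add_const]
    congr 1
    ext w; exact skP_one w
  have htau : ∀ z, skP τ z = 0 → deriv (skP τ) (z + τ) = - exp (-(2 * cπ * I * z)) * deriv (skP τ) z := by
    intro z hz
    rw [← deriv_comp_add_const]
    have : (fun x => skP τ (x + τ)) = (fun z => - exp (-(2 * cπ * I * z))) * skP τ := by
      ext w; exact skP_tau ht hτ w
    rw [this, deriv_mul (by fun_prop) (hd z), hz]
    simp
  obtain ⟨m, l, rfl⟩ := skP_zero_imp ht hτ h
  have := (sk_lat τ (fun z => skP τ z = 0 ∧ deriv (skP τ) z ≠ 0) (by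
    intro z; rw [skP_one, hone]) (by
    intro z
    have e : - exp (-(2 * cπ * I * z)) ≠ 0 := neg_ne_zero.mpr (exp_ne_zero _)
    rw [skP_tau ht hτ, mul_eq_zero_iff_left e]
    constructor
    · rintro ⟨a, b⟩
      refine ⟨a, ?_⟩
      rw [htau z a] at b
      exact right_ne_zero_of_mul b
    · rintro ⟨a, b⟩
      refine ⟨a, ?_⟩
      rw [htau z a]
      exact mul_ne_zero e b) m l 0).2 h0
  rw [zero_add] at this
  exact this.2

lemma sk_theta_lat (m l : ℤ) : θf τ (m + l * τ) = 0 := by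
  have := (sk_lat τ (fun z => θf τ z = 0) (by intro z; rw [sk_theta_add_one]; simp)
    (by intro z; rw [sk_theta_add_tau]; simp [exp_ne_zero]) m l 0).2 (sk_theta_zero τ)
  simpa using this

/-- theta is, up to an elementary factor, the product -/
lemma sk_theta_prod (ht : 0 < t) (hτ : τ = t * I) :
    ∃ c : ℂ, c ≠ 0 ∧ ∀ z, θf τ z = c * exp (-(cπ * I * z)) * skP τ z := by
  obtain ⟨ψ, hψ, h⟩ := sk_div (φ := fun z => exp (cπ * I * z) * θf τ z) (P := skP τ)
    (by have := sk_theta_diff (sk_tau_im ht hτ); fun_prop) (skP_diff ht hτ) (by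
      intro z hz
      refine ⟨skP_deriv ht hτ hz, ?_⟩
      obtain ⟨m, l, rfl⟩ := skP_zero_imp ht hτ hz
      simp only [sk_theta_lat, mul_zero])
  have hdens : Dense {z : ℂ | skP τ z ≠ 0} := by
    have : {z : ℂ | skP τ z ≠ 0} = {z | skP τ z = 0}ᶜ := rfl
    rw [this]
    apply Set.Countable.dense_compl ℂ
    apply (Set.countable_range (fun q : ℤ × ℤ => (q.1 : ℂ) + q.2 * τ)).mono
    intro z hz
    obtain ⟨m, l, h⟩ := skP_zero_imp ht hτ hz
    exact ⟨(m, l), h.symm⟩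
  have h1 : ∀ z, ψ (z + 1) = ψ z := by
    have : (fun z => ψ (z + 1)) = ψ := by
      apply Continuous.ext_on hdens (by have := hψ.continuous; fun_prop) hψ.continuous
      intro z hz
      apply mul_left_cancel₀ hz
      have e := h (z + 1)
      simp only [skP_one, sk_theta_add_one, mul_add, exp_add, mul_one, sk_exp_pi] at e
      simp only
      rw [← e, ← h z]; ring
    exact fun z => congrFun this z
  have h2 : ∀ z, ψ (z + τ) = ψ z := by
    have : (fun z => ψ (z + τ)) = ψ := by
      apply Continuous.ext_on hdens (by have := hψ.continuous; fun_prop) hψ.continuous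
      intro z hz
      have e := h (z + τ)
      simp only [skP_tau ht hτ, sk_theta_add_tau] at e
      have hne : exp (-(2 * cπ * I * z)) * skP τ z ≠ 0 := mul_ne_zero (exp_ne_zero _) hz
      apply mul_left_cancel₀ hne
      have e2 : exp (cπ * I * (z + τ)) * exp (- (cπ * I * τ) - 2 * cπ * I * z)
        = exp (-(2 * cπ * I * z)) * exp (cπ * I * z) := by
        rw [← exp_add, ← exp_add]; congr 1; ring
      simp only
      linear_combination e + θf τ z * e2 + exp (-(2 * cπ * I * z)) * h z
    exact fun z => congrFun this z
  have hc : ∀ z, ψ z = ψ 0 := fun z => sk_elliptic_const ht hτ hψ h1 h2 z 0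
  have hform : ∀ z, θf τ z = ψ 0 * exp (-(cπ * I * z)) * skP τ z := by
    intro z
    have := h z
    rw [hc z] at this
    have e : exp (-(cπ * I * z)) * exp (cπ * I * z) = 1 := by rw [← exp_add]; simp
    linear_combination exp (-(cπ * I * z)) * this - θf τ z * e
  refine ⟨ψ 0, ?_, hform⟩
  intro h0
  obtain ⟨x, hx⟩ := sk_theta_ne ht hτ
  apply hx
  rw [hform, h0]; ring

lemma sk_theta_zero_imp (ht : 0 < t) (hτ : τ = t * I) {z : ℂ} (h : θf τ z = 0) :
    ∃ m l : ℤ, z = m + l * τ := by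
  obtain ⟨c, hc, hf⟩ := sk_theta_prod ht hτ
  rw [hf] at h
  apply skP_zero_imp ht hτ
  simpa [hc, exp_ne_zero] using h

lemma sk_theta_deriv (ht : 0 < t) (hτ : τ = t * I) {z : ℂ} (h : θf τ z = 0) :
    deriv (θf τ) z ≠ 0 := by
  obtain ⟨c, hc, hf⟩ := sk_theta_prod ht hτ
  have hz : skP τ z = 0 := by
    rw [hf] at h
    simpa [hc, exp_ne_zero] using h
  have : θf τ = (fun z => c * exp (-(cπ * I * z))) * skP τ := by ext w; exact hf w
  rw [this, deriv_mul (by fun_prop) (skP_diff ht hτ z), hz]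
  simp only [mul_zero, zero_add]
  exact mul_ne_zero (mul_ne_zero hc (exp_ne_zero _)) (skP_deriv ht hτ hz)

/-- division by an affine theta -/
lemma sk_div_theta (ht : 0 < t) (hτ : τ = t * I) {φ : ℂ → ℂ} (hφ : Differentiable ℂ φ) (a b : ℂ)
    (ha : a ≠ 0) (h : ∀ z, θf τ (a * z + b) = 0 → φ z = 0) :
    ∃ ψ : ℂ → ℂ, Differentiable ℂ ψ ∧ ∀ z, φ z = θf τ (a * z + b) * ψ z := by
  have hd := sk_theta_diff (sk_tau_im ht hτ)
  refine sk_div (P := fun z => θf τ (a * z + b)) hφ (by fun_prop) ?_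
  intro z hz
  refine ⟨?_, h z hz⟩
  have e1 : HasDerivAt (fun z : ℂ => a * z + b) a z := by
    simpa using ((hasDerivAt_id z).const_mul a).add_const b
  have e2 : HasDerivAt (fun z : ℂ => θf τ (a * z + b)) (deriv (θf τ) (a * z + b) * a) z :=
    HasDerivAt.comp (h₂ := θf τ) z (hd (a * z + b)).hasDerivAt e1
  rw [e2.deriv]
  exact mul_ne_zero (sk_theta_deriv ht hτ hz) ha

lemma sk_dense (ht : 0 < t) (hτ : τ = t * I) (a b : ℂ) (ha : a ≠ 0) :
    {z : ℂ | θf τ (a * z + b) = 0}.Countable := by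
  apply (Set.countable_range (fun q : ℤ × ℤ => ((q.1 : ℂ) + q.2 * τ - b) / a)).mono
  intro z hz
  obtain ⟨m, l, h⟩ := sk_theta_zero_imp ht hτ hz
  refine ⟨(m, l), ?_⟩
  simp only
  rw [← h]; field_simp; ring
end

lemma sk_theta_add_two (τ x : ℂ) : θf τ (x + 2) = θf τ x := by
  rw [show x + 2 = x + 1 + 1 by ring, sk_theta_add_one, sk_theta_add_one, neg_neg]

lemma sk_theta_sub_one (τ x : ℂ) : θf τ (x - 1) = - θf τ x := by
  have := sk_theta_add_one τ (x - 1)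
  rw [sub_add_cancel] at this
  rw [this, neg_neg]

lemma sk_theta_sub_two (τ x : ℂ) : θf τ (x - 2) = θf τ x := by
  rw [show x - 2 = x - 1 - 1 by ring, sk_theta_sub_one, sk_theta_sub_one, neg_neg]

lemma sk_theta_sub_tau (τ x : ℂ) :
    θf τ (x - τ) = - exp (- (cπ * I * τ) + 2 * cπ * I * x) * θf τ x := by
  have := sk_theta_add_tau τ (x - τ)
  rw [sub_add_cancel] at this
  rw [this, ← mul_assoc, neg_mul_neg, ← exp_add, show - (cπ * I * τ) + 2 * cπ * I * x +
    (-(cπ * I * τ) - 2 * cπ * I * (x - τ)) = 0 by ring, exp_zero, one_mul]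

lemma sk_theta_add_two_tau (τ x : ℂ) :
    θf τ (x + 2 * τ) = exp (- 4 * (cπ * I * τ) - 4 * cπ * I * x) * θf τ x := by
  rw [show x + 2 * τ = x + τ + τ by ring, sk_theta_add_tau, sk_theta_add_tau, ← mul_assoc,
    neg_mul_neg, ← exp_add]
  congr 2; ring

lemma sk_theta_sub_two_tau (τ x : ℂ) :
    θf τ (x - 2 * τ) = exp (- 4 * (cπ * I * τ) + 4 * cπ * I * x) * θf τ x := by
  rw [show x - 2 * τ = x - τ - τ by ring, sk_theta_sub_tau, sk_theta_sub_tau, ← mul_assoc,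
    neg_mul_neg, ← exp_add]
  congr 2; ring

/-- product of four thetas -/
def skF (τ n a₁ a₂ a₃ a₄ x : ℂ) : ℂ :=
  θf τ (x + a₁ - n/2) * θf τ (x + a₂ - n/2) * θf τ (x + a₃ - n/2) * θf τ (x + a₄ - n/2)

section
variable {τ n a₁ a₂ a₃ a₄ : ℂ}

lemma skF_one (x : ℂ) : skF τ n a₁ a₂ a₃ a₄ (x + 1) = skF τ n a₁ a₂ a₃ a₄ x := by
  unfold skF
  have h : ∀ a, θf τ (x + 1 + a - n/2) = - θf τ (x + a - n/2) := fun a => by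
    rw [show x + 1 + a - n/2 = x + a - n/2 + 1 by ring, sk_theta_add_one]
  simp only [h]; ring

lemma skF_sub_one (x : ℂ) : skF τ n a₁ a₂ a₃ a₄ (x - 1) = skF τ n a₁ a₂ a₃ a₄ x := by
  have := skF_one (τ := τ) (n := n) (a₁ := a₁) (a₂ := a₂) (a₃ := a₃) (a₄ := a₄) (x - 1)
  rw [sub_add_cancel] at this
  exact this.symm

lemma skF_tau (ha : a₁ + a₂ + a₃ + a₄ = 0) (x : ℂ) : skF τ n a₁ a₂ a₃ a₄ (x + τ) =
    exp (-4 * (cπ * I * τ) - 8 * cπ * I * x + 4 * cπ * I * n) * skF τ n a₁ a₂ a₃ a₄ x := by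
  unfold skF
  have h : ∀ a, θf τ (x + τ + a - n/2) =
      - exp (- (cπ * I * τ) - 2 * cπ * I * (x + a - n/2)) * θf τ (x + a - n/2) := fun a => by
    rw [show x + τ + a - n/2 = x + a - n/2 + τ by ring, sk_theta_add_tau]
  have e : exp (-4 * (cπ * I * τ) - 8 * cπ * I * x + 4 * cπ * I * n) =
     exp (- (cπ * I * τ) - 2 * cπ * I * (x + a₁ - n/2)) * exp (- (cπ * I * τ) - 2 * cπ * I * (x + a₂ - n/2)) *
     exp (- (cπ * I * τ) - 2 * cπ * I * (x + a₃ - n/2)) * exp (- (cπ * I * τ) - 2 * cπ * I * (x + a₄ - n/2)) := by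
    simp only [← exp_add]
    congr 1
    linear_combination (2 * cπ * I) * ha
  simp only [h]; rw [e]; ring

lemma skF_sub_tau (ha : a₁ + a₂ + a₃ + a₄ = 0) (x : ℂ) : skF τ n a₁ a₂ a₃ a₄ (x - τ) =
    exp (-4 * (cπ * I * τ) + 8 * cπ * I * x - 4 * cπ * I * n) * skF τ n a₁ a₂ a₃ a₄ x := by
  have := skF_tau (τ := τ) (n := n) ha (x - τ)
  rw [sub_add_cancel] at this
  rw [this, ← mul_assoc, ← exp_add, show -4 * (cπ * I * τ) + 8 * cπ * I * x - 4 * cπ * I * n +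
    (-4 * (cπ * I * τ) - 8 * cπ * I * (x - τ) + 4 * cπ * I * n) = 0 by ring, exp_zero, one_mul]

lemma skF_neg (x : ℂ) : skF τ n (-a₁) (-a₂) (-a₃) (-a₄) (-x) =
    θf τ (x + a₁ + n/2) * θf τ (x + a₂ + n/2) * θf τ (x + a₃ + n/2) * θf τ (x + a₄ + n/2) := by
  unfold skF
  have h : ∀ a, θf τ (-x + -a - n/2) = - θf τ (x + a + n/2) := fun a => by
    rw [← sk_theta_neg]; congr 1; ring
  simp only [h]; ring

lemma skF_refl (x : ℂ) : skF τ n a₁ a₂ a₃ a₄ (n - x) = skF τ n (-a₁) (-a₂) (-a₃) (-a₄) x := by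
  unfold skF
  have h : ∀ a, θf τ (n - x + a - n/2) = - θf τ (x + -a - n/2) := fun a => by
    rw [← sk_theta_neg]; congr 1; ring
  simp only [h]; ring

lemma sk_theta_lat_iff (x : ℂ) (m l : ℤ) : θf τ (x + m + l * τ) = 0 ↔ θf τ x = 0 :=
  sk_lat τ (fun z => θf τ z = 0) (by intro z; rw [sk_theta_add_one]; simp)
    (by intro z; rw [sk_theta_add_tau]; simp [exp_ne_zero]) m l x

/-- the four-term expression -/
def skPsi (τ n a₁ a₂ a₃ a₄ U W : ℂ) : ℂ :=
  skF τ n a₁ a₂ a₃ a₄ U * θf τ (2*W) * θf τ (U + W + n) * θf τ (U - W + n)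
  - skF τ n a₁ a₂ a₃ a₄ (-U) * θf τ (2*W) * θf τ (U + W - n) * θf τ (U - W - n)
  + skF τ n (-a₁) (-a₂) (-a₃) (-a₄) W * θf τ (2*U) * θf τ (U + W + n) * θf τ (U - W - n)
  - skF τ n (-a₁) (-a₂) (-a₃) (-a₄) (-W) * θf τ (2*U) * θf τ (U + W - n) * θf τ (U - W + n)

lemma skPsi_one (U W : ℂ) : skPsi τ n a₁ a₂ a₃ a₄ (U + 1) W = skPsi τ n a₁ a₂ a₃ a₄ U W := by
  unfold skPsi
  rw [skF_one, show -(U+1) = -U - 1 by ring, skF_sub_one, show 2*(U+1) = 2*U+2 by ring,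
    sk_theta_add_two, show U + 1 + W + n = U + W + n + 1 by ring,
    show U + 1 - W + n = U - W + n + 1 by ring, show U + 1 + W - n = U + W - n + 1 by ring,
    show U + 1 - W - n = U - W - n + 1 by ring]
  simp only [sk_theta_add_one]
  ring

lemma skPsi_tau (ha : a₁ + a₂ + a₃ + a₄ = 0) (U W : ℂ) : skPsi τ n a₁ a₂ a₃ a₄ (U + τ) W =
    exp (-6 * (cπ * I * τ) - 12 * cπ * I * U) * skPsi τ n a₁ a₂ a₃ a₄ U W := by
  unfold skPsi
  rw [skF_tau ha, show -(U+τ) = -U - τ by ring, skF_sub_tau ha, show 2*(U+τ) = 2*U+2*τ by ring,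
    sk_theta_add_two_tau, show U + τ + W + n = U + W + n + τ by ring,
    show U + τ - W + n = U - W + n + τ by ring, show U + τ + W - n = U + W - n + τ by ring,
    show U + τ - W - n = U - W - n + τ by ring]
  simp only [sk_theta_add_tau]
  have e1 : exp (-6 * (cπ * I * τ) - 12 * cπ * I * U) =
    exp (-4 * (cπ * I * τ) - 8 * cπ * I * U + 4 * cπ * I * n) *
    exp (- (cπ * I * τ) - 2 * cπ * I * (U + W + n)) * exp (- (cπ * I * τ) - 2 * cπ * I * (U - W + n)) := by
    simp only [← exp_add]; congr 1; ring
  have e2 : exp (-6 * (cπ * I * τ) - 12 * cπ * I * U) =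
    exp (-4 * (cπ * I * τ) + 8 * cπ * I * -U - 4 * cπ * I * n) *
    exp (- (cπ * I * τ) - 2 * cπ * I * (U + W - n)) * exp (- (cπ * I * τ) - 2 * cπ * I * (U - W - n)) := by
    simp only [← exp_add]; congr 1; ring
  have e3 : exp (-6 * (cπ * I * τ) - 12 * cπ * I * U) =
    exp (-4 * (cπ * I * τ) - 4 * cπ * I * (2 * U)) *
    exp (- (cπ * I * τ) - 2 * cπ * I * (U + W + n)) * exp (- (cπ * I * τ) - 2 * cπ * I * (U - W - n)) := by
    simp only [← exp_add]; congr 1; ring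
  have e4 : exp (-6 * (cπ * I * τ) - 12 * cπ * I * U) =
    exp (-4 * (cπ * I * τ) - 4 * cπ * I * (2 * U)) *
    exp (- (cπ * I * τ) - 2 * cπ * I * (U + W - n)) * exp (- (cπ * I * τ) - 2 * cπ * I * (U - W + n)) := by
    simp only [← exp_add]; congr 1; ring
  linear_combination
    (-(skF τ n a₁ a₂ a₃ a₄ U * θf τ (2*W) * θf τ (U + W + n) * θf τ (U - W + n))) * e1
    + (skF τ n a₁ a₂ a₃ a₄ (-U) * θf τ (2*W) * θf τ (U + W - n) * θf τ (U - W - n)) * e2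
    - (skF τ n (-a₁) (-a₂) (-a₃) (-a₄) W * θf τ (2*U) * θf τ (U + W + n) * θf τ (U - W - n)) * e3
    + (skF τ n (-a₁) (-a₂) (-a₃) (-a₄) (-W) * θf τ (2*U) * θf τ (U + W - n) * θf τ (U - W + n)) * e4

lemma skPsi_lat (ha : a₁ + a₂ + a₃ + a₄ = 0) (U W : ℂ) (m l : ℤ) :
    skPsi τ n a₁ a₂ a₃ a₄ (U + m + l * τ) W = 0 ↔ skPsi τ n a₁ a₂ a₃ a₄ U W = 0 :=
  sk_lat τ (fun z => skPsi τ n a₁ a₂ a₃ a₄ z W = 0) (by intro z; rw [skPsi_one])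
    (by intro z; rw [skPsi_tau ha]; simp [exp_ne_zero]) m l U

/-- vanishing at half periods -/
lemma skPsi_half (ha : a₁ + a₂ + a₃ + a₄ = 0) (W : ℂ) (m l : ℤ) :
    skPsi τ n a₁ a₂ a₃ a₄ ((m + l * τ)/2) W = 0 := by
  have main : ∀ ε δ : ℤ, (ε = 0 ∨ ε = 1) → (δ = 0 ∨ δ = 1) →
      skPsi τ n a₁ a₂ a₃ a₄ ((ε + δ * τ)/2) W = 0 := by
    intro ε δ hε hδ
    set E : ℂ → ℂ := fun U => skF τ n a₁ a₂ a₃ a₄ U * θf τ (U + W + n) * θf τ (U - W + n) with hE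
    have h1 : ∀ U, E (U + 1) = E U := by
      intro U
      simp only [hE, skF_one, show U + 1 + W + n = U + W + n + 1 by ring,
        show U + 1 - W + n = U - W + n + 1 by ring, sk_theta_add_one]
      ring
    have h2 : ∀ U, E (U + τ) = exp (-6 * (cπ * I * τ) - 12 * cπ * I * U) * E U := by
      intro U
      have e1 : exp (-6 * (cπ * I * τ) - 12 * cπ * I * U) =
        exp (-4 * (cπ * I * τ) - 8 * cπ * I * U + 4 * cπ * I * n) *
        exp (- (cπ * I * τ) - 2 * cπ * I * (U + W + n)) * exp (- (cπ * I * τ) - 2 * cπ * I * (U - W + n)) := by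
        simp only [← exp_add]; congr 1; ring
      simp only [hE, skF_tau ha, show U + τ + W + n = U + W + n + τ by ring,
        show U + τ - W + n = U - W + n + τ by ring, sk_theta_add_tau]
      rw [e1]
      ring
    set U : ℂ := (ε + δ * τ)/2 with hU
    have hz : θf τ (2 * U) = 0 := by
      rw [hU, show 2 * ((ε + δ * τ : ℂ)/2) = ε + δ * τ by ring]; exact sk_theta_lat ε δ
    have h3 : skPsi τ n a₁ a₂ a₃ a₄ U W = θf τ (2 * W) * (E U - E (-U)) := by
      unfold skPsi
      simp only [hE]
      rw [hz, show -U + W + n = -(U - W - n) by ring, show -U - W + n = -(U + W - n) by ring,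
        sk_theta_neg, sk_theta_neg]
      ring
    rw [h3]
    have h4 : E U = E (-U) := by
      rcases hε with rfl | rfl <;> rcases hδ with rfl | rfl
      · simp [hU]
      · rw [show U = -U + τ by rw [hU]; push_cast; ring, h2, neg_add, neg_neg]
        rw [show -6 * (cπ * I * τ) - 12 * cπ * I * -U = 0 by rw [hU]; push_cast; ring,
          show U + -τ = -U by rw [hU]; push_cast; ring]
        simp
      · rw [show U = -U + 1 by rw [hU]; push_cast; ring, h1, neg_add, neg_neg]
        rw [show U + -1 = -U by rw [hU]; push_cast; ring]
      · have e : E (-U + 1 + τ) = E (-U) := by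
          rw [h2, h1]
          have := sk_exp_int (-3)
          rw [show -6 * (cπ * I * τ) - 12 * cπ * I * (-U + 1) = 2 * cπ * I * ((-3 : ℤ) : ℂ) by
            rw [hU]; push_cast; ring, this, one_mul]
        rw [← e]
        congr 1
        rw [hU]; push_cast; ring
    rw [h4]; ring
  have h2 : ∀ m : ℤ, ∃ k ε : ℤ, m = 2 * k + ε ∧ (ε = 0 ∨ ε = 1) := fun m =>
    ⟨m / 2, m % 2, by omega, by omega⟩
  obtain ⟨k, ε, rfl, hε⟩ := h2 m
  obtain ⟨j, δ, rfl, hδ⟩ := h2 l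
  rw [show (((2 * k + ε : ℤ) : ℂ) + ((2 * j + δ : ℤ) : ℂ) * τ)/2 = (ε + δ * τ)/2 + k + j * τ by
    push_cast; ring, skPsi_lat ha]
  exact main ε δ hε hδ

lemma skPsi_z1 (W : ℂ) : skPsi τ n a₁ a₂ a₃ a₄ (-W + n) W = 0 := by
  unfold skPsi
  rw [show -W + n = n - W by ring, skF_refl, show n - W + W - n = 0 by ring, sk_theta_zero,
    show n - W - W - n = -(2 * W) by ring, sk_theta_neg, show n - W - W + n = 2 * (n - W) by ring]
  ring

lemma skPsi_z2 (W : ℂ) : skPsi τ n a₁ a₂ a₃ a₄ (-W - n) W = 0 := by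
  unfold skPsi
  have := skF_refl (τ := τ) (n := n) (a₁ := a₁) (a₂ := a₂) (a₃ := a₃) (a₄ := a₄) (-W)
  rw [show -(-W - n) = n - -W by ring, this, show -W - n + W + n = 0 by ring, sk_theta_zero,
    show -W - n - W + n = -(2 * W) by ring, sk_theta_neg, show -W - n - W - n = 2 * (-W - n) by ring]
  ring

lemma skPsi_z3 (W : ℂ) : skPsi τ n a₁ a₂ a₃ a₄ (W + n) W = 0 := by
  unfold skPsi
  have := skF_refl (τ := τ) (n := n) (a₁ := a₁) (a₂ := a₂) (a₃ := a₃) (a₄ := a₄) (-W)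
  rw [show n - -W = W + n by ring] at this
  rw [this, show W + n - W - n = 0 by ring, sk_theta_zero, show W + n + W - n = 2 * W by ring,
    show W + n + W + n = 2 * (W + n) by ring]
  ring

lemma skPsi_z4 (W : ℂ) : skPsi τ n a₁ a₂ a₃ a₄ (W - n) W = 0 := by
  unfold skPsi
  rw [show -(W - n) = n - W by ring, skF_refl, show W - n - W + n = 0 by ring, sk_theta_zero,
    show W - n + W + n = 2 * W by ring, show W - n + W - n = 2 * (W - n) by ring]
  ring

variable {t : ℝ}

lemma skF_diff (ht : 0 < t) (hτ : τ = t * I) : Differentiable ℂ (skF τ n a₁ a₂ a₃ a₄) := by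
  have := sk_theta_diff (sk_tau_im ht hτ)
  unfold skF
  fun_prop

lemma sk_shift (ht : 0 < t) (hτ : τ = t * I) {U b : ℂ} (h : θf τ (1 * U + b) = 0) :
    (∃ m l : ℤ, U = -b + m + l * τ) ∧ (∀ c, θf τ (U + c) = 0 → θf τ (c - b) = 0) ∧
    (θf τ (2 * U) = 0 → θf τ (2 * b) = 0) := by
  obtain ⟨m, l, hm⟩ := sk_theta_zero_imp ht hτ h
  have hU : U = -b + m + l * τ := by linear_combination hm
  refine ⟨⟨m, l, hU⟩, ?_, ?_⟩
  · intro c hc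
    rw [hU, show -b + m + l * τ + c = (c - b) + m + l * τ by ring, sk_theta_lat_iff] at hc
    exact hc
  · intro hc
    rw [hU, show 2 * (-b + m + l * τ) = -(2 * b) + ((2 * m : ℤ) : ℂ) + ((2 * l : ℤ) : ℂ) * τ by
      push_cast; ring, sk_theta_lat_iff, sk_theta_neg, neg_eq_zero] at hc
    exact hc

lemma skPsi_generic (ht : 0 < t) (hτ : τ = t * I) (ha : a₁ + a₂ + a₃ + a₄ = 0) (W : ℂ)
    (hW : θf τ (2 * W) ≠ 0) (hn : θf τ (2 * n) ≠ 0) (hp : θf τ (2 * W + 2 * n) ≠ 0)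
    (hm : θf τ (2 * W - 2 * n) ≠ 0) (U : ℂ) : skPsi τ n a₁ a₂ a₃ a₄ U W = 0 := by
  have hθ := sk_theta_diff (sk_tau_im ht hτ)
  have hF := skF_diff (n := n) (a₁ := a₁) (a₂ := a₂) (a₃ := a₃) (a₄ := a₄) ht hτ
  have hd : Differentiable ℂ (fun U => skPsi τ n a₁ a₂ a₃ a₄ U W) := by
    unfold skPsi; fun_prop
  have hnW : θf τ (-(2 * W)) ≠ 0 := by rw [sk_theta_neg]; simpa using hW
  have hnn : θf τ (-(2 * n)) ≠ 0 := by rw [sk_theta_neg]; simpa using hn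
  have hnp : θf τ (-(2 * W + 2 * n)) ≠ 0 := by rw [sk_theta_neg]; simpa using hp
  have hnm : θf τ (-(2 * W - 2 * n)) ≠ 0 := by rw [sk_theta_neg]; simpa using hm
  obtain ⟨ψ1, d1, h1⟩ := sk_div_theta ht hτ hd 2 0 two_ne_zero (by
    intro z hz
    rw [add_zero] at hz
    obtain ⟨m, l, h⟩ := sk_theta_zero_imp ht hτ hz
    have : z = (m + l * τ)/2 := by rw [← h]; ring
    rw [this]; exact skPsi_half ha W m l)
  simp only [add_zero] at h1
  obtain ⟨ψ2, d2, h2⟩ := sk_div_theta ht hτ d1 1 (W - n) one_ne_zero (by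
    intro z hz
    obtain ⟨⟨m, l, hz0⟩, -, hz2⟩ := sk_shift ht hτ hz
    have hΨ : skPsi τ n a₁ a₂ a₃ a₄ z W = 0 := by
      rw [hz0, skPsi_lat ha, show -(W - n) = -W + n by ring]; exact skPsi_z1 W
    rw [h1 z] at hΨ
    refine (mul_eq_zero.1 hΨ).resolve_left fun h => hm ?_
    have := hz2 h
    rwa [mul_sub] at this)
  obtain ⟨ψ3, d3, h3⟩ := sk_div_theta ht hτ d2 1 (W + n) one_ne_zero (by
    intro z hz
    obtain ⟨⟨m, l, hz0⟩, hz1, hz2⟩ := sk_shift ht hτ hz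
    have hΨ : skPsi τ n a₁ a₂ a₃ a₄ z W = 0 := by
      rw [hz0, skPsi_lat ha, show -(W + n) = -W - n by ring]; exact skPsi_z2 W
    rw [h1 z, h2 z] at hΨ
    refine (mul_eq_zero.1 ((mul_eq_zero.1 hΨ).resolve_left fun h => hp ?_)).resolve_left fun h => hnn ?_
    · have := hz2 h
      rwa [mul_add] at this
    · rw [one_mul] at h
      have := hz1 _ h
      rwa [show W - n - (W + n) = -(2 * n) by ring] at this)
  obtain ⟨ψ4, d4, h4⟩ := sk_div_theta ht hτ d3 1 (-W - n) one_ne_zero (by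
    intro z hz
    obtain ⟨⟨m, l, hz0⟩, hz1, hz2⟩ := sk_shift ht hτ hz
    have hΨ : skPsi τ n a₁ a₂ a₃ a₄ z W = 0 := by
      rw [hz0, skPsi_lat ha, show -(-W - n) = W + n by ring]; exact skPsi_z3 W
    rw [h1 z, h2 z, h3 z] at hΨ
    refine (mul_eq_zero.1 ((mul_eq_zero.1 ((mul_eq_zero.1 hΨ).resolve_left 
      fun h => hnp ?_)).resolve_left fun h => hW ?_)).resolve_left fun h => hp ?_
    · have := hz2 h
      rwa [show 2 * (-W - n) = -(2 * W + 2 * n) by ring] at this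
    · rw [one_mul] at h
      have := hz1 _ h
      rwa [show W - n - (-W - n) = (2 * W) by ring] at this
    · rw [one_mul] at h
      have := hz1 _ h
      rwa [show W + n - (-W - n) = 2 * W + 2 * n by ring] at this)
  obtain ⟨ψ5, d5, h5⟩ := sk_div_theta ht hτ d4 1 (-W + n) one_ne_zero (by
    intro z hz
    obtain ⟨⟨m, l, hz0⟩, hz1, hz2⟩ := sk_shift ht hτ hz
    have hΨ : skPsi τ n a₁ a₂ a₃ a₄ z W = 0 := by
      rw [hz0, skPsi_lat ha, show -(-W + n) = W - n by ring]; exact skPsi_z4 W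
    rw [h1 z, h2 z, h3 z, h4 z] at hΨ
    refine (mul_eq_zero.1 ((mul_eq_zero.1 ((mul_eq_zero.1 ((mul_eq_zero.1 hΨ).resolve_left 
      fun h => hnm ?_)).resolve_left fun h => hm ?_)).resolve_left fun h => hW ?_)).resolve_left
      fun h => hnn ?_
    · have := hz2 h
      rwa [show 2 * (-W + n) = -(2 * W - 2 * n) by ring] at this
    · rw [one_mul] at h
      have := hz1 _ h
      rwa [show W - n - (-W + n) = (2 * W - 2 * n) by ring] at this
    · rw [one_mul] at h
      have := hz1 _ h
      rwa [show W + n - (-W + n) = 2 * W by ring] at this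
    · rw [one_mul] at h
      have := hz1 _ h
      rwa [show -W - n - (-W + n) = -(2 * n) by ring] at this)
  set Q : ℂ → ℂ := fun U => θf τ (2 * U) * θf τ (U + (W - n)) * θf τ (U + (W + n)) *
    θf τ (U + (-W - n)) * θf τ (U + (-W + n)) with hQ
  have hQΨ : ∀ z, skPsi τ n a₁ a₂ a₃ a₄ z W = Q z * ψ5 z := by
    intro z
    rw [h1 z, h2 z, h3 z, h4 z, h5 z]
    simp only [hQ, one_mul]; ring
  have hQ1 : ∀ z, Q (z + 1) = Q z := by
    intro z
    simp only [hQ, show 2 * (z + 1) = 2 * z + 2 by ring, sk_theta_add_two, add_right_comm z 1,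
      sk_theta_add_one]
    ring
  have hQ2 : ∀ z, Q (z + τ) = exp (-8 * (cπ * I * τ) - 16 * cπ * I * z) * Q z := by
    intro z
    have e : exp (-8 * (cπ * I * τ) - 16 * cπ * I * z) = exp (-4 * (cπ * I * τ) - 4 * cπ * I * (2 * z)) *
      exp (- (cπ * I * τ) - 2 * cπ * I * (z + (W - n))) * exp (- (cπ * I * τ) - 2 * cπ * I * (z + (W + n))) *
      exp (- (cπ * I * τ) - 2 * cπ * I * (z + (-W - n))) * exp (- (cπ * I * τ) - 2 * cπ * I * (z + (-W + n))) := by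
      simp only [← exp_add]; congr 1; ring
    simp only [hQ, show 2 * (z + τ) = 2 * z + 2 * τ by ring, sk_theta_add_two_tau, add_right_comm z τ,
      sk_theta_add_tau]
    rw [e]; ring
  have hdens : Dense {z : ℂ | Q z ≠ 0} := by
    have hc : {z : ℂ | Q z = 0}.Countable := by
      refine (((((sk_dense ht hτ 2 0 two_ne_zero).union (sk_dense ht hτ 1 (W-n) one_ne_zero)).union
        (sk_dense ht hτ 1 (W+n) one_ne_zero)).union (sk_dense ht hτ 1 (-W-n) one_ne_zero)).union
        (sk_dense ht hτ 1 (-W+n) one_ne_zero)).mono ?_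
      intro z hz
      simpa [hQ, or_assoc] using hz
    exact hc.dense_compl ℂ
  set χ : ℂ → ℂ := fun z => ψ5 z * (θf τ z) ^ 2 with hχ
  have dχ : Differentiable ℂ χ := by fun_prop
  have c1 : ∀ z, χ (z + 1) = χ z := by
    have : (fun z => χ (z + 1)) = χ := by
      apply Continuous.ext_on hdens (by have := dχ.continuous; fun_prop) dχ.continuous
      intro z hz
      apply mul_left_cancel₀ hz
      have e1 := hQΨ (z + 1)
      rw [skPsi_one, hQΨ z, hQ1] at e1
      simp only [hχ, sk_theta_add_one]
      linear_combination - (θf τ z)^2 * e1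
    exact fun z => congrFun this z
  have c2 : ∀ z, χ (z + τ) = χ z := by
    have : (fun z => χ (z + τ)) = χ := by
      apply Continuous.ext_on hdens (by have := dχ.continuous; fun_prop) dχ.continuous
      intro z hz
      apply mul_left_cancel₀ hz
      have e1 := hQΨ (z + τ)
      rw [skPsi_tau ha, hQΨ z, hQ2] at e1
      simp only [hχ, sk_theta_add_tau]
      have e2 : exp (-8 * (cπ * I * τ) - 16 * cπ * I * z) * (exp (8 * (cπ * I * τ) + 16 * cπ * I * z)) = 1 := by
        rw [← exp_add, show -8 * (cπ * I * τ) - 16 * cπ * I * z + (8 * (cπ * I * τ) + 16 * cπ * I * z) = 0 by ring, exp_zero]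
      have e3 : (exp (8 * (cπ * I * τ) + 16 * cπ * I * z)) * exp (-6 * (cπ * I * τ) - 12 * cπ * I * z) *
         exp (- (cπ * I * τ) - 2 * cπ * I * z) ^ 2 = 1 := by
        rw [sq, ← exp_add, ← exp_add, ← exp_add]
        convert exp_zero using 2
        ring
      set A := exp (8 * (cπ * I * τ) + 16 * cπ * I * z)
      set B := exp (- (cπ * I * τ) - 2 * cπ * I * z)
      linear_combination (-A * B^2 * (θf τ z)^2) * e1 - Q z * ψ5 (z + τ) * B^2 * (θf τ z)^2 * e2
        + Q z * ψ5 z * (θf τ z)^2 * e3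
    exact fun z => congrFun this z
  have hχ0 : ∀ z, χ z = 0 := by
    intro z
    rw [sk_elliptic_const ht hτ dχ c1 c2 z 0]
    simp [hχ, sk_theta_zero]
  have hψ : ψ5 = fun _ => 0 := by
    have hd0 : Dense {z : ℂ | θf τ (1 * z + 0) = 0}ᶜ :=
      (sk_dense ht hτ 1 0 one_ne_zero).dense_compl ℂ
    apply Continuous.ext_on hd0 d5.continuous continuous_const
    intro z hz
    have hz' : θf τ z ≠ 0 := by simpa using hz
    have := hχ0 z
    simpa [hχ, hz'] using this
  rw [hQΨ, hψ, mul_zero]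

lemma skPsi_zero (ht : 0 < t) (hτ : τ = t * I) (ha : a₁ + a₂ + a₃ + a₄ = 0) (U W : ℂ) :
    skPsi τ n a₁ a₂ a₃ a₄ U W = 0 := by
  have hθ := (sk_theta_diff (sk_tau_im ht hτ)).continuous
  have step1 : ∀ n, θf τ (2 * n) ≠ 0 → ∀ W, skPsi τ n a₁ a₂ a₃ a₄ U W = 0 := by
    intro n hn W
    have hc := ((sk_dense ht hτ 2 0 two_ne_zero).union (sk_dense ht hτ 2 (2*n) two_ne_zero)).union
      (sk_dense ht hτ 2 (-(2*n)) two_ne_zero)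
    have : (fun W => skPsi τ n a₁ a₂ a₃ a₄ U W) = fun _ => 0 := by
      apply Continuous.ext_on (hc.dense_compl ℂ) (by unfold skPsi skF; fun_prop) continuous_const
      intro W hW
      simp only [Set.mem_compl_iff, Set.mem_union, Set.mem_setOf_eq, not_or, add_zero] at hW
      exact skPsi_generic ht hτ ha W hW.1.1 hn hW.1.2 hW.2 U
    exact congrFun this W
  have : (fun n => skPsi τ n a₁ a₂ a₃ a₄ U W) = fun _ => 0 := by
    apply Continuous.ext_on ((sk_dense ht hτ 2 0 two_ne_zero).dense_compl ℂ)
      (by unfold skPsi skF; fun_prop) continuous_const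
    intro n hn
    simp only [Set.mem_compl_iff, Set.mem_setOf_eq, add_zero] at hn
    exact step1 n hn W
  exact congrFun this n
end

/-- the product over `N+2` shifts -/
def skQ (τ η : ℂ) (N : ℕ) (c : ℂ) : ℂ :=
  ∏ k ∈ Finset.range (N+2), θf τ (c + (2*(k:ℂ) - N - 1)*η + 1/2 + τ/2)

/-- the product over `N+1` shifts -/
def skPc (τ η : ℂ) (N : ℕ) (c : ℂ) : ℂ :=
  ∏ k ∈ Finset.range (N+1), θf τ (c + (2*(k:ℂ) - N)*η + 1/2 + τ/2)

lemma skQ_add (τ η : ℂ) (N : ℕ) (c : ℂ) :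
    skQ τ η N (c + η) = skPc τ η N c * θf τ (c + (N+2)*η + 1/2 + τ/2) := by
  unfold skQ skPc
  rw [Finset.prod_range_succ]
  congr 1
  · apply Finset.prod_congr rfl
    intro k _
    congr 1; ring
  · congr 1; push_cast; ring

lemma skQ_sub (τ η : ℂ) (N : ℕ) (c : ℂ) :
    skQ τ η N (c - η) = skPc τ η N c * θf τ (c - (N+2)*η + 1/2 + τ/2) := by
  unfold skQ skPc
  rw [Finset.prod_range_succ']
  congr 1
  · apply Finset.prod_congr rfl
    intro k _
    congr 1; push_cast; ring
  · congr 1; push_cast; ring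

lemma sk_sum_zero (M : ℕ) (B : ℂ) : ∑ k ∈ Finset.range M, (2*(k:ℂ) - M + 1)*B = 0 := by
  rw [← Finset.sum_mul]
  have : ∑ k ∈ Finset.range M, (2*(k:ℂ) - M + 1) = 0 := by
    have h : ∀ c : ℂ, ∑ k ∈ Finset.range M, (2*(k:ℂ) - c + 1) = M * (M - c) := by
      intro c
      induction M with
      | zero => simp
      | succ k ih => rw [Finset.sum_range_succ, ih]; push_cast; ring
    rw [h]; ring
  rw [this, zero_mul]

lemma skQ_tau (τ η : ℂ) (N : ℕ) (c : ℂ) : skQ τ η N (c + 2*τ) =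
    exp ((N+2) * (-6 * (cπ * I * τ) - 4 * cπ * I * c)) * skQ τ η N c := by
  have e : exp ((N+2) * (-6 * (cπ * I * τ) - 4 * cπ * I * c)) =
    ∏ k ∈ Finset.range (N+2), exp (-6 * (cπ * I * τ) - 4 * cπ * I * c +
      (2*(k:ℂ) - (N+2 : ℕ) + 1) * (-4 * cπ * I * η)) := by
    rw [← exp_sum, Finset.sum_add_distrib, sk_sum_zero, Finset.sum_const, Finset.card_range]
    congr 1
    rw [nsmul_eq_mul]; push_cast; ring
  rw [e]
  unfold skQ
  rw [← Finset.prod_mul_distrib]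
  apply Finset.prod_congr rfl
  intro k _
  rw [show c + 2*τ + (2*(k:ℂ) - N - 1)*η + 1/2 + τ/2 = c + (2*(k:ℂ) - N - 1)*η + 1/2 + τ/2 + 2*τ by ring,
    sk_theta_add_two_tau]
  congr 1
  have h := sk_exp_int (-1)
  rw [show -4 * (cπ * I * τ) - 4 * cπ * I * (c + (2*(k:ℂ) - N - 1)*η + 1/2 + τ/2) =
    (-6 * (cπ * I * τ) - 4 * cπ * I * c +
      (2*(k:ℂ) - (N+2 : ℕ) + 1) * (-4 * cπ * I * η)) + 2 * cπ * I * ((-1 : ℤ) : ℂ) by push_cast; ring,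
    exp_add, h, mul_one]

lemma skQ_one (τ η : ℂ) (N : ℕ) (c : ℂ) : skQ τ η N (c + 2) = skQ τ η N c := by
  unfold skQ
  apply Finset.prod_congr rfl
  intro k _
  rw [show c + 2 + (2*(k:ℂ) - N - 1)*η + 1/2 + τ/2 = c + (2*(k:ℂ) - N - 1)*η + 1/2 + τ/2 + 2 by ring,
    sk_theta_add_two]

section
variable {τ : ℂ} {t : ℝ} {N : ℕ}

lemma sk_ne_im (ht : 0 < t) (hτ : τ = t * I) {w : ℂ} (j : ℤ) (hw : w.im = (j + 1/2) * t) :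
    θf τ w ≠ 0 := by
  intro h
  obtain ⟨m, l, h⟩ := sk_theta_zero_imp ht hτ h
  have h2 := congrArg Complex.im h
  rw [hw, hτ] at h2
  simp at h2
  have h3 : (j : ℝ) + 1/2 = l := by
    rcases h2 with h2 | h2
    · linarith
    · exact absurd h2 ht.ne'
  have h4 : ((2 * j + 1 : ℤ) : ℝ) = ((2 * l : ℤ) : ℝ) := by push_cast; linarith
  have := Int.cast_injective h4
  omega

lemma sk_ne_re (ht : 0 < t) (hτ : τ = t * I) {w : ℂ} (r : ℝ) (hw : w.re = r + 1/2) (hr : |r| < 1/2) :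
    θf τ w ≠ 0 := by
  intro h
  obtain ⟨m, l, h⟩ := sk_theta_zero_imp ht hτ h
  have h2 := congrArg Complex.re h
  rw [hw, hτ] at h2
  simp at h2
  rw [abs_lt] at hr
  have h3 : (0:ℝ) < m := by linarith
  have h4 : (m:ℝ) < 1 := by linarith
  have h5 : 0 < m := by exact_mod_cast h3
  have h6 : m < 1 := by exact_mod_cast h4
  omega

variable {η : ℝ}

lemma sk_eta (hη : |η| < 1 / (2 * ((N:ℝ) + 1))) : ((N:ℝ) + 1) * |η| < 1/2 := by
  have h : (0:ℝ) < 2 * ((N:ℝ) + 1) := by positivity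
  rw [lt_div_iff₀ h] at hη
  linarith

lemma skQ_ne_re (ht : 0 < t) (hτ : τ = t * I) (hη : |η| < 1 / (2 * ((N:ℝ) + 1))) {c : ℂ} (hc : c.re = 0) :
    skQ τ η N c ≠ 0 := by
  unfold skQ
  rw [Finset.prod_ne_zero_iff]
  intro k hk
  have hk' : (k:ℝ) ≤ N + 1 := by
    have := Finset.mem_range.1 hk
    have : k ≤ N + 1 := by omega
    exact_mod_cast this
  apply sk_ne_re ht hτ ((2*(k:ℝ) - N - 1)*η)
  · rw [hτ]; simp [hc]
  · rw [abs_mul]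
    have h0 : (0:ℝ) ≤ k := Nat.cast_nonneg k
    have : |2*(k:ℝ) - N - 1| ≤ N + 1 := by rw [abs_le]; constructor <;> linarith
    exact (mul_le_mul_of_nonneg_right this (abs_nonneg _)).trans_lt (sk_eta hη)

lemma skPc_ne_re (ht : 0 < t) (hτ : τ = t * I) (hη : |η| < 1 / (2 * ((N:ℝ) + 1))) {c : ℂ} (hc : |c.re| ≤ |η|) :
    skPc τ η N c ≠ 0 := by
  unfold skPc
  rw [Finset.prod_ne_zero_iff]
  intro k hk
  have hk' : (k:ℝ) ≤ N := by
    have := Finset.mem_range.1 hk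
    have : k ≤ N := by omega
    exact_mod_cast this
  apply sk_ne_re ht hτ (c.re + (2*(k:ℝ) - N)*η)
  · rw [hτ]; simp
  · refine (abs_add_le _ _).trans_lt ?_
    rw [abs_mul]
    have h0 : (0:ℝ) ≤ k := Nat.cast_nonneg k
    have : |2*(k:ℝ) - N| ≤ N := by rw [abs_le]; constructor <;> linarith
    have := (mul_le_mul_of_nonneg_right this (abs_nonneg η))
    have := sk_eta hη
    linarith

lemma skQ_ne_im (ht : 0 < t) (hτ : τ = t * I) {c : ℂ} (hc : c.im = 0) :
    skQ τ η N c ≠ 0 := by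
  unfold skQ
  rw [Finset.prod_ne_zero_iff]
  intro k hk
  apply sk_ne_im ht hτ 0
  rw [hτ]; simp [hc]; ring

lemma skPc_ne_im (ht : 0 < t) (hτ : τ = t * I) {c : ℂ} (hc : c.im = 0) :
    skPc τ η N c ≠ 0 := by
  unfold skPc
  rw [Finset.prod_ne_zero_iff]
  intro k hk
  apply sk_ne_im ht hτ 0
  rw [hτ]; simp [hc]; ring

lemma skQ_diff (ht : 0 < t) (hτ : τ = t * I) (η : ℂ) : Differentiable ℂ (skQ τ η N) := by
  have := sk_theta_diff (sk_tau_im ht hτ)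
  unfold skQ
  fun_prop

lemma skPc_diff (ht : 0 < t) (hτ : τ = t * I) (η : ℂ) : Differentiable ℂ (skPc τ η N) := by
  have := sk_theta_diff (sk_tau_im ht hτ)
  unfold skPc
  fun_prop
end

/-- exponential part of the weight -/
def skE (N : ℕ) (u : ℂ) : ℂ := exp (-(2*cπ*I*u*(N+2)))

def skL1 (τ η : ℂ) (N : ℕ) (a₁ a₂ a₃ a₄ : ℂ) (f G : ℂ → ℂ) (U V : ℂ) : ℂ :=
  skF τ ((N+2)*η) a₁ a₂ a₃ a₄ U * f U * G V * θf τ (2*V) * skE N (U - η) /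
    (skQ τ η N (U + V - η) * skQ τ η N (U - V - η))

def skL2 (τ η : ℂ) (N : ℕ) (a₁ a₂ a₃ a₄ : ℂ) (f G : ℂ → ℂ) (U V : ℂ) : ℂ :=
  -(skF τ ((N+2)*η) a₁ a₂ a₃ a₄ (-U) * f U * G V * θf τ (2*V) * skE N (U + η) /
    (skQ τ η N (U + V + η) * skQ τ η N (U - V + η)))

def skR1 (τ η : ℂ) (N : ℕ) (a₁ a₂ a₃ a₄ : ℂ) (f G : ℂ → ℂ) (U V : ℂ) : ℂ :=
  exp (cπ*I*τ - 4*cπ*I*V + 2*cπ*I*((N+2)*η)) *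
    skF τ ((N+2)*η) (-a₁) (-a₂) (-a₃) (-a₄) (V - 1/2 - τ/2) * f U * G V * θf τ (2*U) * skE N U /
    (skQ τ η N (U + V - η) * skQ τ η N (U - V + η))

def skR2 (τ η : ℂ) (N : ℕ) (a₁ a₂ a₃ a₄ : ℂ) (f G : ℂ → ℂ) (U V : ℂ) : ℂ :=
  -(exp (cπ*I*τ - 4*cπ*I*V - 2*cπ*I*((N+2)*η)) *
    skF τ ((N+2)*η) (-a₁) (-a₂) (-a₃) (-a₄) (-(V - 1/2 - τ/2)) * f U * G V * θf τ (2*U) * skE N U /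
    (skQ τ η N (U + V + η) * skQ τ η N (U - V - η)))

section
variable {τ n a₁ a₂ a₃ a₄ : ℂ}

def skNp (τ n a₁ a₂ a₃ a₄ U W : ℂ) : ℂ :=
  skF τ n a₁ a₂ a₃ a₄ U * θf τ (2*W) * θf τ (U + W + n)
  - skF τ n (-a₁) (-a₂) (-a₃) (-a₄) (-W) * θf τ (2*U) * θf τ (U + W - n)

def skNm (τ n a₁ a₂ a₃ a₄ U W : ℂ) : ℂ :=
  - (skF τ n a₁ a₂ a₃ a₄ (-U) * θf τ (2*W) * θf τ (U + W - n))
  + skF τ n (-a₁) (-a₂) (-a₃) (-a₄) W * θf τ (2*U) * θf τ (U + W + n)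

variable {t : ℝ}

lemma skNp_zero (ht : 0 < t) (hτ : τ = t * I) (ha : a₁ + a₂ + a₃ + a₄ = 0) (U W : ℂ)
    (h : θf τ (U - W - n) = 0) : skNp τ n a₁ a₂ a₃ a₄ U W = 0 := by
  obtain ⟨m, l, h⟩ := sk_theta_zero_imp ht hτ h
  have hU : U = (W + n) + m + l * τ := by linear_combination h
  have h1 : ∀ U, skNp τ n a₁ a₂ a₃ a₄ (U + 1) W = - skNp τ n a₁ a₂ a₃ a₄ U W := by
    intro U
    unfold skNp
    rw [skF_one, show 2*(U+1) = 2*U+2 by ring, sk_theta_add_two,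
      show U + 1 + W + n = U + W + n + 1 by ring, show U + 1 + W - n = U + W - n + 1 by ring,
      sk_theta_add_one, sk_theta_add_one]
    ring
  have h2 : ∀ U, skNp τ n a₁ a₂ a₃ a₄ (U + τ) W =
      - exp (-5 * (cπ * I * τ) - 10 * cπ * I * U - 2 * cπ * I * W + 2 * cπ * I * n) *
        skNp τ n a₁ a₂ a₃ a₄ U W := by
    intro U
    have e1 : exp (-5 * (cπ * I * τ) - 10 * cπ * I * U - 2 * cπ * I * W + 2 * cπ * I * n) =
      exp (-4 * (cπ * I * τ) - 8 * cπ * I * U + 4 * cπ * I * n) *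
      exp (- (cπ * I * τ) - 2 * cπ * I * (U + W + n)) := by
      rw [← exp_add]; congr 1; ring
    have e2 : exp (-5 * (cπ * I * τ) - 10 * cπ * I * U - 2 * cπ * I * W + 2 * cπ * I * n) =
      exp (-4 * (cπ * I * τ) - 4 * cπ * I * (2 * U)) *
      exp (- (cπ * I * τ) - 2 * cπ * I * (U + W - n)) := by
      rw [← exp_add]; congr 1; ring
    unfold skNp
    rw [skF_tau ha, show 2*(U+τ) = 2*U+2*τ by ring, sk_theta_add_two_tau,
      show U + τ + W + n = U + W + n + τ by ring, show U + τ + W - n = U + W - n + τ by ring,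
      sk_theta_add_tau, sk_theta_add_tau]
    linear_combination (skF τ n a₁ a₂ a₃ a₄ U * θf τ (2*W) * θf τ (U + W + n)) * e1
      - (skF τ n (-a₁) (-a₂) (-a₃) (-a₄) (-W) * θf τ (2*U) * θf τ (U + W - n)) * e2
  rw [hU]
  refine (sk_lat τ (fun z => skNp τ n a₁ a₂ a₃ a₄ z W = 0) (by intro z; rw [h1]; simp)
    (by intro z; rw [h2]; simp [exp_ne_zero]) m l (W + n)).2 ?_
  unfold skNp
  have := skF_refl (τ := τ) (n := n) (a₁ := a₁) (a₂ := a₂) (a₃ := a₃) (a₄ := a₄) (-W)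
  rw [show n - -W = W + n by ring] at this
  rw [this, show W + n + W - n = 2 * W by ring, show W + n + W + n = 2 * (W + n) by ring]
  ring

lemma sk_theta_one_tau (τ x : ℂ) :
    θf τ (x + 1 + τ) = exp (-(cπ*I*τ) - 2*cπ*I*x) * θf τ x := by
  rw [sk_theta_add_tau, sk_theta_add_one, neg_mul_neg]
  congr 1
  have h := sk_exp_int (-1)
  rw [show -(cπ*I*τ) - 2*cπ*I*(x+1) = -(cπ*I*τ) - 2*cπ*I*x + 2*cπ*I*((-1:ℤ):ℂ) by push_cast; ring,
    exp_add, h, mul_one]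

variable {η : ℂ} {N : ℕ} {f G : ℂ → ℂ}

def skPref (τ η : ℂ) (N : ℕ) (f G : ℂ → ℂ) (U V : ℂ) : ℂ :=
  f U * G V * skE N U * exp (2*cπ*I*(U - (V - 1/2 - τ/2))) /
    (skPc τ η N (U + V) * skPc τ η N (U - V))

lemma sk_plus (hn : n = (N+2)*η) {U V W : ℂ} (hW : W = V - 1/2 - τ/2) (h1 : θf τ (U + W - n) ≠ 0)
    (h2 : θf τ (U + W + n) ≠ 0) (h3 : θf τ (U - W - n) ≠ 0) (h4 : skPc τ η N (U + V) ≠ 0)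
    (h5 : skPc τ η N (U - V) ≠ 0) :
    skL1 τ η N a₁ a₂ a₃ a₄ f G U V + skR2 τ η N a₁ a₂ a₃ a₄ f G U V =
    skPref τ η N f G U V * (skNp τ n a₁ a₂ a₃ a₄ U W /
      (θf τ (U + W - n) * θf τ (U + W + n) * θf τ (U - W - n))) := by
  unfold skL1 skR2 skPref skNp
  rw [skQ_sub, skQ_sub, skQ_add, ← hn, ← hW,
    show U + V - n + 1/2 + τ/2 = U + W - n + 1 + τ by rw [hW]; ring,
    show U + V + n + 1/2 + τ/2 = U + W + n + 1 + τ by rw [hW]; ring,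
    show U - V - n + 1/2 + τ/2 = U - W - n by rw [hW]; ring,
    show 2 * V = 2 * W + 1 + τ by rw [hW]; ring, sk_theta_one_tau, sk_theta_one_tau, sk_theta_one_tau]
  have hV : V = W + 1/2 + τ/2 := by rw [hW]; ring
  have e1 : skE N (U - η) = skE N U * exp (2*cπ*I*n) := by
    unfold skE; rw [← exp_add, hn]; congr 1; ring
  have e2 : exp (-(cπ*I*τ) - 2*cπ*I*(U + W - n)) =
      exp (2*cπ*I*n) * (exp (cπ*I*τ))⁻¹ * (exp (2*cπ*I*U))⁻¹ * (exp (2*cπ*I*W))⁻¹ := by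
    simp only [← exp_neg, ← exp_add]; congr 1; ring
  have e3 : exp (-(cπ*I*τ) - 2*cπ*I*(U + W + n)) =
      (exp (2*cπ*I*n))⁻¹ * (exp (cπ*I*τ))⁻¹ * (exp (2*cπ*I*U))⁻¹ * (exp (2*cπ*I*W))⁻¹ := by
    simp only [← exp_neg, ← exp_add]; congr 1; ring
  have e4 : exp (-(cπ*I*τ) - 2*cπ*I*(2 * W)) =
      (exp (cπ*I*τ))⁻¹ * (exp (2*cπ*I*W))⁻¹ * (exp (2*cπ*I*W))⁻¹ := by
    simp only [← exp_neg, ← exp_add]; congr 1; ring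
  have e5 : exp (cπ*I*τ - 4*cπ*I*V - 2*cπ*I*n) =
      (exp (cπ*I*τ))⁻¹ * (exp (2*cπ*I*W))⁻¹ * (exp (2*cπ*I*W))⁻¹ * (exp (2*cπ*I*n))⁻¹ := by
    have h := sk_exp_int (-1)
    refine Eq.trans ?_ ((congrArg (_ * ·) h).trans (mul_one _))
    simp only [← exp_neg, ← exp_add]; congr 1; rw [hV]; push_cast; ring
  have e6 : exp (2*cπ*I*(U - W)) = exp (2*cπ*I*U) * (exp (2*cπ*I*W))⁻¹ := by
    simp only [← exp_neg, ← exp_add]; congr 1; ring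
  rw [e1, e2, e3, e4, e5, e6]
  have x1 := exp_ne_zero (2*cπ*I*n)
  have x2 := exp_ne_zero (cπ*I*τ)
  have x3 := exp_ne_zero (2*cπ*I*U)
  have x4 := exp_ne_zero (2*cπ*I*W)
  generalize exp (2*cπ*I*n) = q at *
  generalize exp (cπ*I*τ) = T at *
  generalize exp (2*cπ*I*U) = Ud at *
  generalize exp (2*cπ*I*W) = Wd at *
  field_simp
  ring

lemma sk_minus (hn : n = (N+2)*η) {U V W : ℂ} (hW : W = V - 1/2 - τ/2) (h1 : θf τ (U + W - n) ≠ 0)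
    (h2 : θf τ (U + W + n) ≠ 0) (h3 : θf τ (U - W + n) ≠ 0) (h4 : skPc τ η N (U + V) ≠ 0)
    (h5 : skPc τ η N (U - V) ≠ 0) :
    skL2 τ η N a₁ a₂ a₃ a₄ f G U V + skR1 τ η N a₁ a₂ a₃ a₄ f G U V =
    skPref τ η N f G U V * (skNm τ n a₁ a₂ a₃ a₄ U W /
      (θf τ (U + W - n) * θf τ (U + W + n) * θf τ (U - W + n))) := by
  unfold skL2 skR1 skPref skNm
  rw [skQ_add, skQ_add, skQ_sub, ← hn, ← hW,
    show U + V - n + 1/2 + τ/2 = U + W - n + 1 + τ by rw [hW]; ring,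
    show U + V + n + 1/2 + τ/2 = U + W + n + 1 + τ by rw [hW]; ring,
    show U - V + n + 1/2 + τ/2 = U - W + n by rw [hW]; ring,
    show 2 * V = 2 * W + 1 + τ by rw [hW]; ring, sk_theta_one_tau, sk_theta_one_tau, sk_theta_one_tau]
  have hV : V = W + 1/2 + τ/2 := by rw [hW]; ring
  have e1 : skE N (U + η) = skE N U * (exp (2*cπ*I*n))⁻¹ := by
    unfold skE; rw [← exp_neg, ← exp_add, hn]; congr 1; ring
  have e2 : exp (-(cπ*I*τ) - 2*cπ*I*(U + W - n)) =
      exp (2*cπ*I*n) * (exp (cπ*I*τ))⁻¹ * (exp (2*cπ*I*U))⁻¹ * (exp (2*cπ*I*W))⁻¹ := by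
    simp only [← exp_neg, ← exp_add]; congr 1; ring
  have e3 : exp (-(cπ*I*τ) - 2*cπ*I*(U + W + n)) =
      (exp (2*cπ*I*n))⁻¹ * (exp (cπ*I*τ))⁻¹ * (exp (2*cπ*I*U))⁻¹ * (exp (2*cπ*I*W))⁻¹ := by
    simp only [← exp_neg, ← exp_add]; congr 1; ring
  have e4 : exp (-(cπ*I*τ) - 2*cπ*I*(2 * W)) =
      (exp (cπ*I*τ))⁻¹ * (exp (2*cπ*I*W))⁻¹ * (exp (2*cπ*I*W))⁻¹ := by
    simp only [← exp_neg, ← exp_add]; congr 1; ring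
  have e5 : exp (cπ*I*τ - 4*cπ*I*V + 2*cπ*I*n) =
      (exp (cπ*I*τ))⁻¹ * (exp (2*cπ*I*W))⁻¹ * (exp (2*cπ*I*W))⁻¹ * (exp (2*cπ*I*n)) := by
    have h := sk_exp_int (-1)
    refine Eq.trans ?_ ((congrArg (_ * ·) h).trans (mul_one _))
    simp only [← exp_neg, ← exp_add]; congr 1; rw [hV]; push_cast; ring
  have e6 : exp (2*cπ*I*(U - W)) = exp (2*cπ*I*U) * (exp (2*cπ*I*W))⁻¹ := by
    simp only [← exp_neg, ← exp_add]; congr 1; ring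
  rw [e1, e2, e3, e4, e5, e6]
  have x1 := exp_ne_zero (2*cπ*I*n)
  have x2 := exp_ne_zero (cπ*I*τ)
  have x3 := exp_ne_zero (2*cπ*I*U)
  have x4 := exp_ne_zero (2*cπ*I*W)
  generalize exp (2*cπ*I*n) = q at *
  generalize exp (cπ*I*τ) = T at *
  generalize exp (2*cπ*I*U) = Ud at *
  generalize exp (2*cπ*I*W) = Wd at *
  field_simp

lemma skL1_per (ha : a₁ + a₂ + a₃ + a₄ = 0)
    (hf : ∀ x, f (x + τ) = exp (-2*cπ*I*N*(2*x + τ)) * f x)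
    (hG : ∀ x, G (x - τ) = exp (2*cπ*I*N*(2*x - τ)) * G x) (U V : ℂ) :
    skL1 τ η N a₁ a₂ a₃ a₄ f G (U + τ) (V - τ) = skL1 τ η N a₁ a₂ a₃ a₄ f G U V := by
  unfold skL1
  rw [skF_tau ha, hf, hG, show 2 * (V - τ) = 2 * V - 2 * τ by ring, sk_theta_sub_two_tau,
    show U + τ + (V - τ) - η = U + V - η by ring, show U + τ - (V - τ) - η = U - V - η + 2 * τ by ring,
    skQ_tau]
  have e0 : skE N (U + τ - η) = exp (-(2*cπ*I*τ*(N+2))) * skE N (U - η) := by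
    unfold skE; rw [← exp_add]; congr 1; ring
  rw [e0]
  have e : exp (-4*(cπ*I*τ) - 8*cπ*I*U + 4*cπ*I*((N+2)*η)) * exp (-2*cπ*I*N*(2*U + τ)) *
      exp (2*cπ*I*N*(2*V - τ)) * exp (-4*(cπ*I*τ) + 4*cπ*I*(2*V)) * exp (-(2*cπ*I*τ*(N+2))) =
      exp ((N+2) * (-6 * (cπ * I * τ) - 4 * cπ * I * (U - V - η))) := by
    simp only [← exp_add]; congr 1; ring
  rw [← e]
  have y1 := exp_ne_zero (-4*(cπ*I*τ) - 8*cπ*I*U + 4*cπ*I*((N+2)*η))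
  have y2 := exp_ne_zero (-2*cπ*I*N*(2*U + τ))
  have y3 := exp_ne_zero (2*cπ*I*N*(2*V - τ))
  have y4 := exp_ne_zero (-4*(cπ*I*τ) + 4*cπ*I*(2*V))
  have y5 := exp_ne_zero (-(2*cπ*I*τ*(N+2)))
  generalize exp (-4*(cπ*I*τ) - 8*cπ*I*U + 4*cπ*I*((N+2)*η)) = z1 at *
  generalize exp (-2*cπ*I*N*(2*U + τ)) = z2 at *
  generalize exp (2*cπ*I*N*(2*V - τ)) = z3 at *
  generalize exp (-4*(cπ*I*τ) + 4*cπ*I*(2*V)) = z4 at *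
  generalize exp (-(2*cπ*I*τ*(N+2))) = z5 at *
  rw [show skQ τ η N (U + V - η) * (z1 * z2 * z3 * z4 * z5 * skQ τ η N (U - V - η)) =
    (z1 * z2 * z3 * z4 * z5) * (skQ τ η N (U + V - η) * skQ τ η N (U - V - η)) by ring]
  rw [← mul_div_mul_left _ (skQ τ η N (U + V - η) * skQ τ η N (U - V - η))
    (show z1 * z2 * z3 * z4 * z5 ≠ 0 by positivity)]
  congr 1
  ring

lemma skR2_per (ha : a₁ + a₂ + a₃ + a₄ = 0)
    (hf : ∀ x, f (x + τ) = exp (-2*cπ*I*N*(2*x + τ)) * f x)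
    (hG : ∀ x, G (x - τ) = exp (2*cπ*I*N*(2*x - τ)) * G x) (U V : ℂ) :
    skR2 τ η N a₁ a₂ a₃ a₄ f G (U + τ) (V - τ) = skR2 τ η N a₁ a₂ a₃ a₄ f G U V := by
  unfold skR2
  have ha' : -a₁ + -a₂ + -a₃ + -a₄ = 0 := by linear_combination -ha
  rw [show -(V - τ - 1/2 - τ/2) = -(V - 1/2 - τ/2) + τ by ring,
    skF_tau ha', hf, hG, show 2 * (U + τ) = 2 * U + 2 * τ by ring, sk_theta_add_two_tau,
    show U + τ + (V - τ) + η = U + V + η by ring, show U + τ - (V - τ) - η = U - V - η + 2 * τ by ring,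
    skQ_tau]
  have e0 : skE N (U + τ) = exp (-(2*cπ*I*τ*(N+2))) * skE N U := by
    unfold skE; rw [← exp_add]; congr 1; ring
  have e1 : exp (cπ*I*τ - 4*cπ*I*(V-τ) - 2*cπ*I*((N+2)*η)) =
      exp (4*cπ*I*τ) * exp (cπ*I*τ - 4*cπ*I*V - 2*cπ*I*((N+2)*η)) := by
    rw [← exp_add]; congr 1; ring
  rw [e0, e1]
  have e : exp (-4*(cπ*I*τ) - 8*cπ*I*(-(V - 1/2 - τ/2)) + 4*cπ*I*((N+2)*η)) * exp (-2*cπ*I*N*(2*U + τ)) *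
      exp (2*cπ*I*N*(2*V - τ)) * exp (-4*(cπ*I*τ) - 4*cπ*I*(2*U)) * exp (-(2*cπ*I*τ*(N+2))) *
      exp (4*cπ*I*τ) =
      exp ((N+2) * (-6 * (cπ * I * τ) - 4 * cπ * I * (U - V - η))) := by
    have h := sk_exp_int (-2)
    refine Eq.trans ?_ ((congrArg (_ * ·) h).trans (mul_one _))
    simp only [← exp_add]; congr 1; push_cast; ring
  rw [← e]
  have y1 := exp_ne_zero (-4*(cπ*I*τ) - 8*cπ*I*(-(V - 1/2 - τ/2)) + 4*cπ*I*((N+2)*η))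
  have y2 := exp_ne_zero (-2*cπ*I*N*(2*U + τ))
  have y3 := exp_ne_zero (2*cπ*I*N*(2*V - τ))
  have y4 := exp_ne_zero (-4*(cπ*I*τ) - 4*cπ*I*(2*U))
  have y5 := exp_ne_zero (-(2*cπ*I*τ*(N+2)))
  have y6 := exp_ne_zero (4*cπ*I*τ)
  generalize exp (-4*(cπ*I*τ) - 8*cπ*I*(-(V - 1/2 - τ/2)) + 4*cπ*I*((N+2)*η)) = z1 at *
  generalize exp (-2*cπ*I*N*(2*U + τ)) = z2 at *
  generalize exp (2*cπ*I*N*(2*V - τ)) = z3 at *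
  generalize exp (-4*(cπ*I*τ) - 4*cπ*I*(2*U)) = z4 at *
  generalize exp (-(2*cπ*I*τ*(N+2))) = z5 at *
  generalize exp (4*cπ*I*τ) = z6 at *
  rw [show skQ τ η N (U + V + η) * (z1 * z2 * z3 * z4 * z5 * z6 * skQ τ η N (U - V - η)) =
    (z1 * z2 * z3 * z4 * z5 * z6) * (skQ τ η N (U + V + η) * skQ τ η N (U - V - η)) by ring]
  rw [← mul_div_mul_left _ (skQ τ η N (U + V + η) * skQ τ η N (U - V - η))
    (show z1 * z2 * z3 * z4 * z5 * z6 ≠ 0 by positivity)]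
  congr 2
  ring
end

lemma sk_contour {t : ℝ} (ht : 0 < t) {τ : ℂ} (hτ : τ = t * I)
    {N : ℕ} {η : ℝ} (hη : |η| < 1 / (2 * ((N:ℝ) + 1)))
    {a₁ a₂ a₃ a₄ : ℂ} (ha : a₁ + a₂ + a₃ + a₄ = 0)
    {f G : ℂ → ℂ} (df : Differentiable ℂ f) (dG : Differentiable ℂ G)
    (hf : ∀ x, f (x + τ) = exp (-2*cπ*I*N*(2*x + τ)) * f x)
    (hG : ∀ x, G (x - τ) = exp (2*cπ*I*N*(2*x - τ)) * G x) (x : ℝ) :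
    (∫ y in (0:ℝ)..t, (skL1 τ η N a₁ a₂ a₃ a₄ f G (x + (η/2 + y*I)) (x - (η/2 + y*I))
        + skR2 τ η N a₁ a₂ a₃ a₄ f G (x + (η/2 + y*I)) (x - (η/2 + y*I)))) +
    (∫ y in (0:ℝ)..t, (skL2 τ η N a₁ a₂ a₃ a₄ f G (x + (-η/2 + y*I)) (x - (-η/2 + y*I))
        + skR1 τ η N a₁ a₂ a₃ a₄ f G (x + (-η/2 + y*I)) (x - (-η/2 + y*I)))) = 0 := by
  have hθ := sk_theta_diff (sk_tau_im ht hτ)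
  obtain ⟨n, hn⟩ : ∃ n : ℂ, n = (N+2)*η := ⟨_, rfl⟩
  have hnr : n.re = (N+2)*η := by rw [hn]; simp
  have hni : n.im = 0 := by rw [hn]; simp
  have hτr : τ.re = 0 := by rw [hτ]; simp
  have hτi : τ.im = t := by rw [hτ]; simp
  have hF := skF_diff (n := n) (a₁ := a₁) (a₂ := a₂) (a₃ := a₃) (a₄ := a₄) ht hτ
  have hF' := skF_diff (n := n) (a₁ := -a₁) (a₂ := -a₂) (a₃ := -a₃) (a₄ := -a₄) ht hτ
  have hdp : Differentiable ℂ (fun z : ℂ => skNp τ n a₁ a₂ a₃ a₄ (x + z) (x - z - 1/2 - τ/2)) := by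
    unfold skNp; fun_prop
  have hdm : Differentiable ℂ (fun z : ℂ => skNm τ n a₁ a₂ a₃ a₄ (x + z) (x - z - 1/2 - τ/2)) := by
    unfold skNm; fun_prop
  obtain ⟨X, dX, hX⟩ := sk_div_theta ht hτ hdp 2 (1/2 + τ/2 - n) two_ne_zero (by
    intro z hz
    apply skNp_zero ht hτ ha
    rw [← hz]; congr 1; ring)
  have hXm : ∀ z : ℂ, skNm τ n a₁ a₂ a₃ a₄ (x + z) (x - z - 1/2 - τ/2) =
      - (θf τ (2 * z + (1/2 + τ/2 + n)) * X z) := by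
    have : (fun z : ℂ => skNm τ n a₁ a₂ a₃ a₄ (x + z) (x - z - 1/2 - τ/2)) = fun z =>
      - (θf τ (2 * z + (1/2 + τ/2 + n)) * X z) := by
      apply Continuous.ext_on ((sk_dense ht hτ 2 (1/2 + τ/2 - n) two_ne_zero).dense_compl ℂ)
        hdm.continuous (by have := dX.continuous; have := hθ.continuous; fun_prop)
      intro z hz
      have hz' : θf τ (2 * z + (1/2 + τ/2 - n)) ≠ 0 := by simpa using hz
      apply mul_left_cancel₀ hz'
      have h1 := skPsi_zero (n := n) ht hτ ha (x + z) (x - z - 1/2 - τ/2)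
      have h2 : skPsi τ n a₁ a₂ a₃ a₄ (x + z) (x - z - 1/2 - τ/2) =
        skNp τ n a₁ a₂ a₃ a₄ (x + z) (x - z - 1/2 - τ/2) * θf τ (2 * z + (1/2 + τ/2 + n)) +
        skNm τ n a₁ a₂ a₃ a₄ (x + z) (x - z - 1/2 - τ/2) * θf τ (2 * z + (1/2 + τ/2 - n)) := by
        unfold skPsi skNp skNm
        rw [show (x:ℂ) + z - (x - z - 1/2 - τ/2) + n = 2 * z + (1/2 + τ/2 + n) by ring,
          show (x:ℂ) + z - (x - z - 1/2 - τ/2) - n = 2 * z + (1/2 + τ/2 - n) by ring]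
        ring
      have h3 := hX z
      rw [h1, h3] at h2
      linear_combination -h2
    exact fun z => congrFun this z
  have g1 : θf τ (2 * x - 1/2 - τ/2 - n) ≠ 0 := by
    apply sk_ne_im ht hτ (-1)
    simp [hni, hτi]; ring
  have g2 : θf τ (2 * x - 1/2 - τ/2 + n) ≠ 0 := by
    apply sk_ne_im ht hτ (-1)
    simp [hni, hτi]; ring
  have g3 : skPc τ η N (2 * x) ≠ 0 := by
    apply skPc_ne_im ht hτ
    simp
  have g4 : ∀ z : ℂ, |z.re| ≤ |η|/2 → skPc τ η N (2 * z) ≠ 0 := by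
    intro z hz
    apply skPc_ne_re ht hτ hη
    simp [abs_mul]; linarith
  set H : ℂ → ℂ := fun z => skPref τ η N f G (x + z) (x - z) * (X z /
    (θf τ (2 * x - 1/2 - τ/2 - n) * θf τ (2 * x - 1/2 - τ/2 + n))) with hH
  have hp : ∀ z : ℂ, |z.re| ≤ |η|/2 → θf τ (2 * z + (1/2 + τ/2 - n)) ≠ 0 →
      skL1 τ η N a₁ a₂ a₃ a₄ f G (x + z) (x - z) + skR2 τ η N a₁ a₂ a₃ a₄ f G (x + z) (x - z) = H z := by
    intro z hz hz'
    have e1 : (x:ℂ) + z + (x - z - 1/2 - τ/2) - n = 2 * x - 1/2 - τ/2 - n := by ring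
    have e2 : (x:ℂ) + z + (x - z - 1/2 - τ/2) + n = 2 * x - 1/2 - τ/2 + n := by ring
    have e3 : (x:ℂ) + z - (x - z - 1/2 - τ/2) - n = 2 * z + (1/2 + τ/2 - n) := by ring
    rw [sk_plus hn rfl (by rwa [e1]) (by rwa [e2]) (by rwa [e3])
      (by rw [show (x:ℂ) + z + (x - z) = 2 * x by ring]; exact g3)
      (by rw [show (x:ℂ) + z - (x - z) = 2 * z by ring]; exact g4 z hz)]
    have h3 := hX z
    rw [h3, e1, e2, e3]
    simp only [hH]
    generalize θf τ (2 * z + (1/2 + τ/2 - n)) = q1 at *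
    generalize θf τ (2 * x - 1/2 - τ/2 - n) = q2 at *
    generalize θf τ (2 * x - 1/2 - τ/2 + n) = q3 at *
    field_simp
  have hm : ∀ z : ℂ, |z.re| ≤ |η|/2 → θf τ (2 * z + (1/2 + τ/2 + n)) ≠ 0 →
      skL2 τ η N a₁ a₂ a₃ a₄ f G (x + z) (x - z) + skR1 τ η N a₁ a₂ a₃ a₄ f G (x + z) (x - z) = -H z := by
    intro z hz hz'
    have e1 : (x:ℂ) + z + (x - z - 1/2 - τ/2) - n = 2 * x - 1/2 - τ/2 - n := by ring
    have e2 : (x:ℂ) + z + (x - z - 1/2 - τ/2) + n = 2 * x - 1/2 - τ/2 + n := by ring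
    have e3 : (x:ℂ) + z - (x - z - 1/2 - τ/2) + n = 2 * z + (1/2 + τ/2 + n) := by ring
    rw [sk_minus hn rfl (by rwa [e1]) (by rwa [e2]) (by rwa [e3])
      (by rw [show (x:ℂ) + z + (x - z) = 2 * x by ring]; exact g3)
      (by rw [show (x:ℂ) + z - (x - z) = 2 * z by ring]; exact g4 z hz)]
    rw [hXm z, e1, e2, e3]
    simp only [hH]
    generalize θf τ (2 * z + (1/2 + τ/2 + n)) = q1 at *
    generalize θf τ (2 * x - 1/2 - τ/2 - n) = q2 at *
    generalize θf τ (2 * x - 1/2 - τ/2 + n) = q3 at *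
    field_simp
  have hdH : ∀ z : ℂ, |z.re| ≤ |η|/2 → DifferentiableAt ℂ H z := by
    intro z hz
    have hP := skPc_diff (N := N) ht hτ (η : ℂ)
    have hE : Differentiable ℂ (skE N) := by unfold skE; fun_prop
    have hE' : skPc τ η N (x + z + (x - z)) * skPc τ η N (x + z - (x - z)) ≠ 0 := by
      rw [show (x:ℂ) + z + (x - z) = 2 * x by ring, show (x:ℂ) + z - (x - z) = 2 * z by ring]
      exact mul_ne_zero g3 (g4 z hz)
    simp only [hH]
    unfold skPref
    refine DifferentiableAt.mul (DifferentiableAt.div ?_ ?_ hE') ?_ <;> fun_prop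
  have habs : |η/2| = |η|/2 := by rw [abs_div]; simp
  have hbox := Complex.integral_boundary_rect_eq_zero_of_differentiableOn H (-η/2) (η/2 + t*I) (by
    intro z hz
    apply (hdH z ?_).differentiableWithinAt
    have hz1 : z.re ∈ Set.uIcc (-η/2) (η/2) := by
      have := (Complex.mem_reProdIm.1 hz).1
      simpa using this
    rw [Set.mem_uIcc] at hz1
    rw [← habs]
    rcases hz1 with h | h
    · rw [abs_of_nonneg (by linarith : 0 ≤ η/2), abs_le]; constructor <;> linarith
    · rw [abs_of_nonpos (by linarith : η/2 ≤ 0), abs_le]; constructor <;> linarith)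
  have r1 : (-(η:ℂ)/2).re = -η/2 := by simp
  have r2 : (-(η:ℂ)/2).im = 0 := by simp
  have r3 : ((η:ℂ)/2 + t*I).re = η/2 := by simp
  have r4 : ((η:ℂ)/2 + t*I).im = t := by simp
  rw [r1, r2, r3, r4] at hbox
  have hbt : (∫ s in (-η/2)..(η/2), H (s + ((0:ℝ):ℂ) * I)) = ∫ s in (-η/2)..(η/2), H (s + t * I) := by
    apply intervalIntegral.integral_congr
    intro s hs
    simp only
    have hs' : |s| ≤ |η|/2 := by
      rw [Set.mem_uIcc] at hs
      rw [← habs]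
      rcases hs with h | h
      · rw [abs_of_nonneg (by linarith : 0 ≤ η/2), abs_le]; constructor <;> linarith
      · rw [abs_of_nonpos (by linarith : η/2 ≤ 0), abs_le]; constructor <;> linarith
    rw [← hp _ (by simpa using hs') (by
        apply sk_ne_im ht hτ 0; simp [hni, hτi]; ring),
      ← hp _ (by simpa using hs') (by
        apply sk_ne_im ht hτ 2; simp [hni, hτi]; ring)]
    rw [show (x:ℂ) + (s + t * I) = x + (s + ((0:ℝ):ℂ) * I) + τ by rw [hτ]; push_cast; ring,
      show (x:ℂ) - (s + t * I) = x - (s + ((0:ℝ):ℂ) * I) - τ by rw [hτ]; push_cast; ring,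
      skL1_per ha hf hG, skR2_per ha hf hG]
  rw [hbt, sub_self, zero_add, smul_eq_mul, smul_eq_mul, ← mul_sub] at hbox
  have hbox' := (mul_eq_zero.1 hbox).resolve_left I_ne_zero
  have hsq : |((N:ℝ)+1) * η| < 1/2 := by
    rw [abs_mul, abs_of_nonneg (by positivity : (0:ℝ) ≤ (N:ℝ)+1)]; exact sk_eta hη
  have i1 : (∫ y in (0:ℝ)..t, (skL1 τ η N a₁ a₂ a₃ a₄ f G (x + (η/2 + y*I)) (x - (η/2 + y*I))
        + skR2 τ η N a₁ a₂ a₃ a₄ f G (x + (η/2 + y*I)) (x - (η/2 + y*I)))) =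
      ∫ y in (0:ℝ)..t, H (((η/2 : ℝ):ℂ) + y * I) := by
    apply intervalIntegral.integral_congr
    intro y _
    simp only
    rw [hp _ (by simp [habs]) (by
      apply sk_ne_re ht hτ (-(((N:ℝ)+1) * η))
      · simp [hnr, hτr]; ring
      · rwa [abs_neg])]
    push_cast; rfl
  have i2 : (∫ y in (0:ℝ)..t, (skL2 τ η N a₁ a₂ a₃ a₄ f G (x + (-η/2 + y*I)) (x - (-η/2 + y*I))
        + skR1 τ η N a₁ a₂ a₃ a₄ f G (x + (-η/2 + y*I)) (x - (-η/2 + y*I)))) =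
      - ∫ y in (0:ℝ)..t, H (((-η/2 : ℝ):ℂ) + y * I) := by
    rw [← intervalIntegral.integral_neg]
    apply intervalIntegral.integral_congr
    intro y _
    simp only
    rw [hm _ (by simp [abs_div]) (by
      apply sk_ne_re ht hτ ((((N:ℝ)+1) * η))
      · simp [hnr, hτr]; ring
      · exact hsq)]
    push_cast; rfl
  rw [i1, i2, ← sub_eq_add_neg]
  exact hbox'

section
variable {τ a₁ a₂ a₃ a₄ : ℂ} {η : ℂ} {N : ℕ} {f G : ℂ → ℂ}

lemma sk_Mw (u v : ℂ) : Mw τ η N u v =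
    θf τ (2*u) * θf τ (2*v) * skE N u / (skQ τ η N (u + v) * skQ τ η N (u - v)) := by
  unfold Mw skE skQ
  rw [Finset.prod_mul_distrib, exp_neg]
  rw [← div_div, div_eq_mul_inv (θf τ (2*u) * θf τ (2*v))]

lemma sk_pt_left {Df : ℂ → ℂ}
    (hDfEq : ∀ x, θf τ (2*x) * Df x = ΔRHS τ η N a₁ a₂ a₃ a₄ f x) (u v : ℂ) :
    Df u * G v * Mw τ η N u v = skL1 τ η N a₁ a₂ a₃ a₄ f G (u + η) v +
      skL2 τ η N a₁ a₂ a₃ a₄ f G (u - η) v := by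
  rw [sk_Mw, show Df u * G v * (θf τ (2*u) * θf τ (2*v) * skE N u / (skQ τ η N (u + v) * skQ τ η N (u - v)))
    = (θf τ (2*u) * Df u) * (G v * θf τ (2*v) * skE N u / (skQ τ η N (u + v) * skQ τ η N (u - v))) by ring,
    hDfEq]
  unfold ΔRHS skL1 skL2
  rw [add_sub_cancel_right, sub_add_cancel, show u + η + v - η = u + v by ring,
    show u + η - v - η = u - v by ring, show u - η + v + η = u + v by ring,
    show u - η - v + η = u - v by ring]
  have h1 : skF τ ((N+2)*η) a₁ a₂ a₃ a₄ (u + η) = θf τ (u + a₁ - N*η/2) * θf τ (u + a₂ - N*η/2) *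
    θf τ (u + a₃ - N*η/2) * θf τ (u + a₄ - N*η/2) := by
    have h : ∀ a, θf τ (u + η + a - (N+2)*η/2) = θf τ (u + a - N*η/2) := fun a => by congr 1; ring
    unfold skF; simp only [h]
  have h2 : skF τ ((N+2)*η) a₁ a₂ a₃ a₄ (-(u - η)) = θf τ (u - a₁ + N*η/2) * θf τ (u - a₂ + N*η/2) *
    θf τ (u - a₃ + N*η/2) * θf τ (u - a₄ + N*η/2) := by
    have h : ∀ a, θf τ (-(u - η) + a - (N+2)*η/2) = - θf τ (u - a + N*η/2) := fun a => by
      rw [← sk_theta_neg]; congr 1; ring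
    unfold skF; simp only [h]; ring
  rw [h1, h2]
  ring

lemma sk_sigma {g : ℂ → ℂ} (hg : ThetaSp τ N g) (w : ℂ) :
    exp (2*cπ*I*N*(1/4 + τ/4 + w)) * σop τ N g (w + 1/2 + τ/2) = g w := by
  unfold σop
  obtain ⟨-, h1, h2, -⟩ := hg
  rw [show w + 1/2 + τ/2 + 1/2 + τ/2 = w + 1 + τ by ring, h2, h1, ← mul_assoc, ← mul_assoc, ← exp_add, ← exp_add]
  have h := sk_exp_int (-N)
  rw [show 2*cπ*I*N*(1/4 + τ/4 + w) + 2*cπ*I*N*(1/4 + τ/4 + (w + 1/2 + τ/2)) + -2*cπ*I*N*(2*(w+1) + τ)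
    = 2*cπ*I*((-(N:ℤ) : ℤ):ℂ) by push_cast; ring, h, one_mul]

lemma sk_S {g Dg : ℂ → ℂ} {b₁ b₂ b₃ b₄ : ℂ} (hg : ThetaSp τ N g)
    (hDgEq : ∀ x, θf τ (2*x) * Dg x = ΔRHS τ η N b₁ b₂ b₃ b₄ (σop τ N g) x) (u : ℂ) :
    θf τ (2*u) * σop τ N Dg u = exp (cπ*I*τ + 4*cπ*I*u) * (
      θf τ (u + 1/2 + τ/2 + b₁ - N*η/2) * θf τ (u + 1/2 + τ/2 + b₂ - N*η/2) *
      θf τ (u + 1/2 + τ/2 + b₃ - N*η/2) * θf τ (u + 1/2 + τ/2 + b₄ - N*η/2) *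
        exp (-(2*cπ*I*N*η)) * g (u + η) -
      θf τ (u + 1/2 + τ/2 - b₁ + N*η/2) * θf τ (u + 1/2 + τ/2 - b₂ + N*η/2) *
      θf τ (u + 1/2 + τ/2 - b₃ + N*η/2) * θf τ (u + 1/2 + τ/2 - b₄ + N*η/2) *
        exp (2*cπ*I*N*η) * g (u - η)) := by
  have h1 := hDgEq (u + 1/2 + τ/2)
  have h2 : θf τ (2*u) = exp (cπ*I*τ + 4*cπ*I*u) * θf τ (2*(u + 1/2 + τ/2)) := by
    rw [show 2*(u + 1/2 + τ/2) = 2*u + 1 + τ by ring, sk_theta_one_tau, ← mul_assoc, ← exp_add,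
      show cπ*I*τ + 4*cπ*I*u + (-(cπ*I*τ) - 2*cπ*I*(2*u)) = 0 by ring, exp_zero, one_mul]
  have s1 := sk_sigma hg (u + η)
  have s2 := sk_sigma hg (u - η)
  rw [← s1, ← s2, h2]
  nth_rewrite 1 [σop]
  unfold ΔRHS at h1
  rw [show u + η + 1/2 + τ/2 = u + 1/2 + τ/2 + η by ring, show u - η + 1/2 + τ/2 = u + 1/2 + τ/2 - η by ring]
  have e1 : exp (2*cπ*I*N*(1/4 + τ/4 + (u + η))) = exp (2*cπ*I*N*(1/4 + τ/4 + u)) * exp (2*cπ*I*N*η) := by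
    rw [← exp_add]; congr 1; ring
  have e2 : exp (2*cπ*I*N*(1/4 + τ/4 + (u - η))) = exp (2*cπ*I*N*(1/4 + τ/4 + u)) * exp (-(2*cπ*I*N*η)) := by
    rw [← exp_add]; congr 1; ring
  have e3 : exp (-(2*cπ*I*N*η)) * exp (2*cπ*I*N*η) = 1 := by rw [← exp_add]; simp
  rw [e1, e2]
  generalize exp (2*cπ*I*N*η) = q at *
  generalize exp (-(2*cπ*I*N*η)) = q' at *
  generalize exp (2*cπ*I*N*(1/4 + τ/4 + u)) = E at *
  generalize exp (cπ*I*τ + 4*cπ*I*u) = K at *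
  generalize θf τ (u + 1/2 + τ/2 + b₁ - N*η/2) * θf τ (u + 1/2 + τ/2 + b₂ - N*η/2) *
      θf τ (u + 1/2 + τ/2 + b₃ - N*η/2) * θf τ (u + 1/2 + τ/2 + b₄ - N*η/2) = A at *
  generalize θf τ (u + 1/2 + τ/2 - b₁ + N*η/2) * θf τ (u + 1/2 + τ/2 - b₂ + N*η/2) *
      θf τ (u + 1/2 + τ/2 - b₃ + N*η/2) * θf τ (u + 1/2 + τ/2 - b₄ + N*η/2) = B at *
  linear_combination K * E * h1 + (-K * E * A * σop τ N g (u + 1/2 + τ/2 + η) + K * E * B * σop τ N g (u + 1/2 + τ/2 - η)) * e3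
end

lemma sk_pt_right {t : ℝ} {τ : ℂ} (hτ : τ = t * I) {η : ℝ} {N : ℕ} {a₁ a₂ a₃ a₄ : ℂ}
    {f g Dg : ℂ → ℂ} (hg : ThetaSp τ N g)
    (hDgEq : ∀ x, θf τ (2*x) * Dg x =
      ΔRHS τ (η : ℂ) N (-(starRingEnd ℂ) a₁) (-(starRingEnd ℂ) a₂)
        (-(starRingEnd ℂ) a₃) (-(starRingEnd ℂ) a₄) (σop τ N g) x)
    (u v : ℂ) (hv : v = (starRingEnd ℂ) u) :
    f u * (starRingEnd ℂ) (σop τ N Dg u) * Mw τ η N u v =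
      skR1 τ η N a₁ a₂ a₃ a₄ f (fun w => (starRingEnd ℂ) (g ((starRingEnd ℂ) w))) u (v + η) +
      skR2 τ η N a₁ a₂ a₃ a₄ f (fun w => (starRingEnd ℂ) (g ((starRingEnd ℂ) w))) u (v - η) := by
  have hS := congrArg (starRingEnd ℂ) (sk_S hg hDgEq u)
  have hcu : (starRingEnd ℂ) v = u := by rw [hv, Complex.conj_conj]
  rw [map_mul, sk_theta_conj hτ, map_mul, map_ofNat, ← hv] at hS
  rw [sk_Mw, show f u * (starRingEnd ℂ) (σop τ N Dg u) * (θf τ (2*u) * θf τ (2*v) * skE N u /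
      (skQ τ η N (u + v) * skQ τ η N (u - v))) = (θf τ (2*v) * (starRingEnd ℂ) (σop τ N Dg u)) *
      (f u * θf τ (2*u) * skE N u / (skQ τ η N (u + v) * skQ τ η N (u - v))) by ring, hS]
  have hcτ := sk_conj_tau hτ
  have p1 : ∀ a : ℂ, θf τ (v + 1/2 + -τ/2 - a - N*η/2) = - θf τ (v - 1/2 - τ/2 - a - N*η/2) := by
    intro a; rw [← sk_theta_add_one]; congr 1; ring
  have p2 : ∀ a : ℂ, θf τ (v + 1/2 + -τ/2 + a + N*η/2) = - θf τ (v - 1/2 - τ/2 + a + N*η/2) := by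
    intro a; rw [← sk_theta_add_one]; congr 1; ring
  have h1 : skF τ ((N+2)*η) (-a₁) (-a₂) (-a₃) (-a₄) (v + η - 1/2 - τ/2) =
      θf τ (v - 1/2 - τ/2 - a₁ - N*η/2) * θf τ (v - 1/2 - τ/2 - a₂ - N*η/2) *
      θf τ (v - 1/2 - τ/2 - a₃ - N*η/2) * θf τ (v - 1/2 - τ/2 - a₄ - N*η/2) := by
    have h : ∀ a, θf τ (v + η - 1/2 - τ/2 + -a - (N+2)*η/2) = θf τ (v - 1/2 - τ/2 - a - N*η/2) :=
      fun a => by congr 1; ring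
    unfold skF; simp only [h]
  have h2 : skF τ ((N+2)*η) (-a₁) (-a₂) (-a₃) (-a₄) (-(v - η - 1/2 - τ/2)) =
      θf τ (v - 1/2 - τ/2 + a₁ + N*η/2) * θf τ (v - 1/2 - τ/2 + a₂ + N*η/2) *
      θf τ (v - 1/2 - τ/2 + a₃ + N*η/2) * θf τ (v - 1/2 - τ/2 + a₄ + N*η/2) := by
    have h : ∀ a, θf τ (v - η - 1/2 - τ/2 + a + (N+2)*η/2) = θf τ (v - 1/2 - τ/2 + a + N*η/2) :=
      fun a => by congr 1; ring
    rw [skF_neg]; simp only [h]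
  unfold skR1 skR2
  rw [h1, h2]
  simp only [map_mul, map_sub, map_add, map_neg, map_div₀, map_one, map_ofNat, Complex.conj_conj,
    sk_theta_conj hτ, ← exp_conj, sk_conj_pi, Complex.conj_I, hcτ, Complex.conj_ofReal,
    map_natCast, ← hv, hcu]
  simp only [sub_neg_eq_add, ← sub_eq_add_neg, p1, p2]
  have k1 : exp (cπ*I*τ - 4*cπ*I*(v + η) + 2*cπ*I*((N+2)*η)) =
      exp (cπ * -I * -τ + 4*cπ*(-I)*v) * exp (-(2*cπ*(-I)*N*η)) := by
    rw [← exp_add]; congr 1; ring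
  have k2 : exp (cπ*I*τ - 4*cπ*I*(v - η) - 2*cπ*I*((N+2)*η)) =
      exp (cπ * -I * -τ + 4*cπ*(-I)*v) * exp (2*cπ*(-I)*N*η) := by
    rw [← exp_add]; congr 1; ring
  rw [k1, k2, show u + (v + (η:ℂ)) - η = u + v by ring, show u - (v + (η:ℂ)) + η = u - v by ring,
    show u + (v - (η:ℂ)) + η = u + v by ring, show u - (v - (η:ℂ)) - η = u - v by ring]
  ring

section
variable {τ a₁ a₂ a₃ a₄ : ℂ} {η : ℂ} {N : ℕ} {f G : ℂ → ℂ}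

lemma skE_one (u : ℂ) : skE N (u + 1) = skE N u := by
  unfold skE
  have h := sk_exp_int (-(N + 2))
  rw [show -(2*cπ*I*(u+1)*(N+2)) = -(2*cπ*I*u*(N+2)) + 2*cπ*I*((-((N:ℤ)+2):ℤ):ℂ) by push_cast; ring,
    exp_add, h, mul_one]


lemma skL1_one (hf : ∀ x, f (x + 1) = f x) (hG : ∀ x, G (x + 1) = G x) (U V : ℂ) :
    skL1 τ η N a₁ a₂ a₃ a₄ f G (U + 1) (V + 1) = skL1 τ η N a₁ a₂ a₃ a₄ f G U V := by
  unfold skL1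
  rw [skF_one, hf, hG, show 2*(V+1) = 2*V+2 by ring, sk_theta_add_two,
    show U + 1 - η = U - η + 1 by ring, skE_one, show U + 1 + (V + 1) - η = U + V - η + 2 by ring,
    skQ_one, show U + 1 - (V + 1) - η = U - V - η by ring]

lemma skL2_one (hf : ∀ x, f (x + 1) = f x) (hG : ∀ x, G (x + 1) = G x) (U V : ℂ) :
    skL2 τ η N a₁ a₂ a₃ a₄ f G (U + 1) (V + 1) = skL2 τ η N a₁ a₂ a₃ a₄ f G U V := by
  unfold skL2
  rw [show -(U + 1) = -U - 1 by ring, skF_sub_one, hf, hG, show 2*(V+1) = 2*V+2 by ring, sk_theta_add_two,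
    show U + 1 + η = U + η + 1 by ring, skE_one, show U + 1 + (V + 1) + η = U + V + η + 2 by ring,
    skQ_one, show U + 1 - (V + 1) + η = U - V + η by ring]

lemma skR1_one (hf : ∀ x, f (x + 1) = f x) (hG : ∀ x, G (x + 1) = G x) (U V : ℂ) :
    skR1 τ η N a₁ a₂ a₃ a₄ f G (U + 1) (V + 1) = skR1 τ η N a₁ a₂ a₃ a₄ f G U V := by
  unfold skR1
  have h := sk_exp_int (-2)
  rw [show V + 1 - 1/2 - τ/2 = V - 1/2 - τ/2 + 1 by ring, skF_one, hf, hG,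
    show 2*(U+1) = 2*U+2 by ring, sk_theta_add_two,
    skE_one, show U + 1 + (V + 1) - η = U + V - η + 2 by ring,
    skQ_one, show U + 1 - (V + 1) + η = U - V + η by ring,
    show cπ*I*τ - 4*cπ*I*(V+1) + 2*cπ*I*((N+2)*η) = cπ*I*τ - 4*cπ*I*V + 2*cπ*I*((N+2)*η) +
      2*cπ*I*((-2:ℤ):ℂ) by push_cast; ring, exp_add, h, mul_one]

lemma skR2_one (hf : ∀ x, f (x + 1) = f x) (hG : ∀ x, G (x + 1) = G x) (U V : ℂ) :
    skR2 τ η N a₁ a₂ a₃ a₄ f G (U + 1) (V + 1) = skR2 τ η N a₁ a₂ a₃ a₄ f G U V := by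
  unfold skR2
  have h := sk_exp_int (-2)
  rw [show -(V + 1 - 1/2 - τ/2) = -(V - 1/2 - τ/2) - 1 by ring, skF_sub_one, hf, hG,
    show 2*(U+1) = 2*U+2 by ring, sk_theta_add_two,
    skE_one, show U + 1 + (V + 1) + η = U + V + η + 2 by ring,
    skQ_one, show U + 1 - (V + 1) - η = U - V - η by ring,
    show cπ*I*τ - 4*cπ*I*(V+1) - 2*cπ*I*((N+2)*η) = cπ*I*τ - 4*cπ*I*V - 2*cπ*I*((N+2)*η) +
      2*cπ*I*((-2:ℤ):ℂ) by push_cast; ring, exp_add, h, mul_one]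
end

section
variable {t : ℝ} {τ a₁ a₂ a₃ a₄ : ℂ} {η : ℝ} {N : ℕ} {f G : ℂ → ℂ}

lemma sk_cont (ht : 0 < t) (hτ : τ = t * I) (hη : |η| < 1 / (2 * ((N:ℝ) + 1)))
    (cf : Continuous f) (cG : Continuous G) :
    (Continuous fun p : ℝ × ℝ =>
      skL1 τ η N a₁ a₂ a₃ a₄ f G (p.1 + (η/2 + p.2*I)) (p.1 - (η/2 + p.2*I))) ∧
    (Continuous fun p : ℝ × ℝ =>
      skR2 τ η N a₁ a₂ a₃ a₄ f G (p.1 + (η/2 + p.2*I)) (p.1 - (η/2 + p.2*I))) ∧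
    (Continuous fun p : ℝ × ℝ =>
      skL2 τ η N a₁ a₂ a₃ a₄ f G (p.1 + (-η/2 + p.2*I)) (p.1 - (-η/2 + p.2*I))) ∧
    (Continuous fun p : ℝ × ℝ =>
      skR1 τ η N a₁ a₂ a₃ a₄ f G (p.1 + (-η/2 + p.2*I)) (p.1 - (-η/2 + p.2*I))) := by
  have cθ := (sk_theta_diff (sk_tau_im ht hτ)).continuous
  have cQ := (skQ_diff (N := N) ht hτ (η : ℂ)).continuous
  have cE : Continuous (skE N) := by unfold skE; fun_prop
  have cF := (skF_diff (n := (N+2)*η) (a₁ := a₁) (a₂ := a₂) (a₃ := a₃) (a₄ := a₄) ht hτ).continuous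
  have cF' := (skF_diff (n := (N+2)*η) (a₁ := -a₁) (a₂ := -a₂) (a₃ := -a₃) (a₄ := -a₄) ht hτ).continuous
  unfold skL1 skR2 skL2 skR1
  refine ⟨Continuous.div ?_ ?_ fun p => mul_ne_zero (skQ_ne_im ht hτ ?_) (skQ_ne_re ht hτ hη ?_),
    Continuous.neg (Continuous.div ?_ ?_ fun p => mul_ne_zero (skQ_ne_im ht hτ ?_) (skQ_ne_re ht hτ hη ?_)),
    Continuous.neg (Continuous.div ?_ ?_ fun p => mul_ne_zero (skQ_ne_im ht hτ ?_) (skQ_ne_re ht hτ hη ?_)),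
    Continuous.div ?_ ?_ fun p => mul_ne_zero (skQ_ne_im ht hτ ?_) (skQ_ne_re ht hτ hη ?_)⟩
  all_goals first
    | fun_prop
    | (simp; done)
    | (simp; ring)
end

lemma sk_shift_int {P : ℝ → ℂ} (hP : ∀ x, P (x + 1) = P x) (c : ℝ) :
    ∫ x in (0:ℝ)..1, P (x + c) = ∫ x in (0:ℝ)..1, P x := by
  rw [intervalIntegral.integral_comp_add_right]
  have := Function.Periodic.intervalIntegral_add_eq (f := P) (T := 1) hP c 0
  rw [zero_add] at this
  rw [zero_add, add_comm 1 c]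
  exact this

lemma sk_conj_diff {g : ℂ → ℂ} (hg : Differentiable ℂ g) :
    Differentiable ℂ (fun w => (starRingEnd ℂ) (g ((starRingEnd ℂ) w))) := by
  intro w
  exact (differentiableAt_conj_conj_iff).2 (hg _)

/-- For η ∈ ℝ_N, the adjoint of Δ(a) with respect to the Sklyanin
pairing is −σ∘Δ(−ā)∘σ. -/
theorem sklyanin_adjoint_real
    (t : ℝ) (ht : 0 < t) (τ : ℂ) (hτ : τ = t * I)
    (N : ℕ) (η : ℝ) (hη : |η| < 1 / (2 * (N + 1)))
    (a₁ a₂ a₃ a₄ : ℂ) (ha : a₁ + a₂ + a₃ + a₄ = 0)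
    (f g : ℂ → ℂ) (hf : ThetaSp τ N f) (hg : ThetaSp τ N g)
    (Df : ℂ → ℂ) (hDf : Differentiable ℂ Df)
    (hDfEq : ∀ x, θf τ (2*x) * Df x = ΔRHS τ (η : ℂ) N a₁ a₂ a₃ a₄ f x)
    (Dg : ℂ → ℂ) (hDg : Differentiable ℂ Dg)
    (hDgEq : ∀ x, θf τ (2*x) * Dg x =
      ΔRHS τ (η : ℂ) N (-(starRingEnd ℂ) a₁) (-(starRingEnd ℂ) a₂)
        (-(starRingEnd ℂ) a₃) (-(starRingEnd ℂ) a₄) (σop τ N g) x) :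
    pairing τ (η : ℂ) t N Df g = - pairing τ (η : ℂ) t N f (σop τ N Dg) := by
  obtain ⟨G, hGdef⟩ : ∃ G : ℂ → ℂ, G = fun w => (starRingEnd ℂ) (g ((starRingEnd ℂ) w)) := ⟨_, rfl⟩
  have dG : Differentiable ℂ G := by rw [hGdef]; exact sk_conj_diff hg.1
  have G1 : ∀ x, G (x + 1) = G x := by
    intro x; simp only [hGdef, map_add, map_one, hg.2.1]
  have G2 : ∀ x, G (x - τ) = exp (2*cπ*I*N*(2*x - τ)) * G x := by
    intro x
    simp only [hGdef, map_sub, sk_conj_tau hτ, sub_neg_eq_add, hg.2.2.1, map_mul, ← exp_conj]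
    congr 2
    simp only [map_mul, map_add, map_neg, map_ofNat, Complex.conj_conj, sk_conj_pi, conj_I, map_natCast,
      sk_conj_tau hτ]
    ring
  obtain ⟨c1, c2, c3, c4⟩ := sk_cont (a₁ := a₁) (a₂ := a₂) (a₃ := a₃) (a₄ := a₄) ht hτ hη
    hf.1.continuous dG.continuous
  set P1 : ℝ → ℝ → ℂ := fun x y => skL1 τ η N a₁ a₂ a₃ a₄ f G (x + (η/2 + y*I)) (x - (η/2 + y*I)) with hP1
  set P2 : ℝ → ℝ → ℂ := fun x y => skR2 τ η N a₁ a₂ a₃ a₄ f G (x + (η/2 + y*I)) (x - (η/2 + y*I)) with hP2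
  set P3 : ℝ → ℝ → ℂ := fun x y => skL2 τ η N a₁ a₂ a₃ a₄ f G (x + (-η/2 + y*I)) (x - (-η/2 + y*I)) with hP3
  set P4 : ℝ → ℝ → ℂ := fun x y => skR1 τ η N a₁ a₂ a₃ a₄ f G (x + (-η/2 + y*I)) (x - (-η/2 + y*I)) with hP4
  replace c1 : Continuous fun p : ℝ × ℝ => P1 p.1 p.2 := c1
  replace c2 : Continuous fun p : ℝ × ℝ => P2 p.1 p.2 := c2
  replace c3 : Continuous fun p : ℝ × ℝ => P3 p.1 p.2 := c3
  replace c4 : Continuous fun p : ℝ × ℝ => P4 p.1 p.2 := c4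
  have per1 : ∀ y x, P1 (x + 1) y = P1 x y := by
    intro y x
    simp only [hP1]
    refine Eq.trans ?_ (skL1_one hf.2.1 G1 _ _)
    congr 1 <;> push_cast <;> ring
  have per2 : ∀ y x, P2 (x + 1) y = P2 x y := by
    intro y x
    simp only [hP2]
    refine Eq.trans ?_ (skR2_one hf.2.1 G1 _ _)
    congr 1 <;> push_cast <;> ring
  have per3 : ∀ y x, P3 (x + 1) y = P3 x y := by
    intro y x
    simp only [hP3]
    refine Eq.trans ?_ (skL2_one hf.2.1 G1 _ _)
    congr 1 <;> push_cast <;> ring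
  have per4 : ∀ y x, P4 (x + 1) y = P4 x y := by
    intro y x
    simp only [hP4]
    refine Eq.trans ?_ (skR1_one hf.2.1 G1 _ _)
    congr 1 <;> push_cast <;> ring
  have hcj : ∀ x y : ℝ, (starRingEnd ℂ) ((x:ℂ) + y*I) = x - y*I := by
    intro x y; simp [sub_eq_add_neg]
  have ptL : ∀ x y : ℝ, Df (x + y*I) * (starRingEnd ℂ) (g (x + y*I)) *
      Mw τ η N (x + y*I) ((starRingEnd ℂ) (x + y*I)) = P1 (x + η/2) y + P3 (x + -η/2) y := by
    intro x y
    have h := sk_pt_left (G := G) hDfEq (x + y*I) ((starRingEnd ℂ) (x + y*I))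
    have hGv : G ((starRingEnd ℂ) (x + y*I)) = (starRingEnd ℂ) (g (x + y*I)) := by
      simp only [hGdef, Complex.conj_conj]
    rw [hGv] at h
    rw [h, hcj]
    simp only [hP1, hP3]
    congr 2 <;> push_cast <;> ring
  have ptR : ∀ x y : ℝ, f (x + y*I) * (starRingEnd ℂ) (σop τ N Dg (x + y*I)) *
      Mw τ η N (x + y*I) ((starRingEnd ℂ) (x + y*I)) = P2 (x + -η/2) y + P4 (x + η/2) y := by
    intro x y
    have h := sk_pt_right (f := f) hτ hg hDgEq (x + y*I) ((starRingEnd ℂ) (x + y*I)) rfl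
    rw [← hGdef] at h
    rw [h, hcj, add_comm]
    simp only [hP2, hP4]
    congr 2 <;> push_cast <;> ring
  have cx : ∀ {P : ℝ → ℝ → ℂ}, (Continuous fun p : ℝ × ℝ => P p.1 p.2) → ∀ y, Continuous fun x => P x y :=
    fun h y => h.comp (Continuous.prodMk continuous_id continuous_const)
  have cy : ∀ {P : ℝ → ℝ → ℂ}, (Continuous fun p : ℝ × ℝ => P p.1 p.2) → ∀ x, Continuous fun y => P x y :=
    fun h x => h.comp (Continuous.prodMk continuous_const continuous_id)
  have ii : ∀ {P : ℝ → ℝ → ℂ}, (Continuous fun p : ℝ × ℝ => P p.1 p.2) → ∀ y c, 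
      IntervalIntegrable (fun x => P (x + c) y) volume 0 1 := by
    intro P h y c
    have := cx h y
    exact (this.comp (continuous_id.add continuous_const)).intervalIntegrable _ _
  have inL : ∀ y : ℝ, (∫ x in (0:ℝ)..1, Df (x + y*I) * (starRingEnd ℂ) (g (x + y*I)) *
      Mw τ η N (x + y*I) ((starRingEnd ℂ) (x + y*I))) =
      (∫ x in (0:ℝ)..1, P1 x y) + ∫ x in (0:ℝ)..1, P3 x y := by
    intro y
    simp only [ptL]
    rw [intervalIntegral.integral_add (ii c1 _ _) (ii c3 _ _),
      sk_shift_int (P := fun x => P1 x y) (per1 y), sk_shift_int (P := fun x => P3 x y) (per3 y)]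
  have inR : ∀ y : ℝ, (∫ x in (0:ℝ)..1, f (x + y*I) * (starRingEnd ℂ) (σop τ N Dg (x + y*I)) *
      Mw τ η N (x + y*I) ((starRingEnd ℂ) (x + y*I))) =
      (∫ x in (0:ℝ)..1, P2 x y) + ∫ x in (0:ℝ)..1, P4 x y := by
    intro y
    simp only [ptR]
    rw [intervalIntegral.integral_add (ii c2 _ _) (ii c4 _ _),
      sk_shift_int (P := fun x => P2 x y) (per2 y), sk_shift_int (P := fun x => P4 x y) (per4 y)]
  have swap : ∀ {P : ℝ → ℝ → ℂ}, (Continuous fun p : ℝ × ℝ => P p.1 p.2) →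
      (∫ y in (0:ℝ)..t, ∫ x in (0:ℝ)..1, P x y) = ∫ x in (0:ℝ)..1, ∫ y in (0:ℝ)..t, P x y := by
    intro P h
    refine intervalIntegral_intervalIntegral_swap (F := fun y x => P x y) ?_
    have hc : Continuous (Function.uncurry fun y x => P x y) := h.comp continuous_swap
    exact (hc.continuousOn.integrableOn_compact (isCompact_uIcc.prod isCompact_uIcc)).mono_set
      (Set.prod_mono Set.uIoc_subset_uIcc Set.uIoc_subset_uIcc)
  have oy : ∀ {P : ℝ → ℝ → ℂ}, (Continuous fun p : ℝ × ℝ => P p.1 p.2) →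
      IntervalIntegrable (fun y => ∫ x in (0:ℝ)..1, P x y) volume 0 t := by
    intro P h
    apply Continuous.intervalIntegrable
    exact intervalIntegral.continuous_parametric_intervalIntegral_of_continuous'
      (f := fun y x => P x y) (h.comp continuous_swap) 0 1
  have ox : ∀ {P : ℝ → ℝ → ℂ}, (Continuous fun p : ℝ × ℝ => P p.1 p.2) →
      IntervalIntegrable (fun x => ∫ y in (0:ℝ)..t, P x y) volume 0 1 := by
    intro P h
    apply Continuous.intervalIntegrable
    exact intervalIntegral.continuous_parametric_intervalIntegral_of_continuous'
      (f := fun x y => P x y) h 0 t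
  have key : ∀ x : ℝ, (∫ y in (0:ℝ)..t, P1 x y) + (∫ y in (0:ℝ)..t, P2 x y) +
      ((∫ y in (0:ℝ)..t, P3 x y) + ∫ y in (0:ℝ)..t, P4 x y) = 0 := by
    intro x
    have h := sk_contour ht hτ hη ha hf.1 dG hf.2.2.1 G2 x
    rw [← intervalIntegral.integral_add ((cy c1 x).intervalIntegrable _ _) ((cy c2 x).intervalIntegrable _ _),
      ← intervalIntegral.integral_add ((cy c3 x).intervalIntegrable _ _) ((cy c4 x).intervalIntegrable _ _)]
    exact h
  rw [eq_neg_iff_add_eq_zero]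
  unfold pairing
  simp only [inL, inR]
  rw [intervalIntegral.integral_add (oy c1) (oy c3), intervalIntegral.integral_add (oy c2) (oy c4),
    swap c1, swap c2, swap c3, swap c4]
  have key2 : (∫ x in (0:ℝ)..1, ((∫ y in (0:ℝ)..t, P1 x y) + (∫ y in (0:ℝ)..t, P2 x y) +
      ((∫ y in (0:ℝ)..t, P3 x y) + ∫ y in (0:ℝ)..t, P4 x y))) = 0 := by
    simp only [key]; simp
  rw [intervalIntegral.integral_add ((ox c1).add (ox c2)) ((ox c3).add (ox c4)),
    intervalIntegral.integral_add (ox c1) (ox c2), intervalIntegral.integral_add (ox c3) (ox c4)] at key2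
  rw [← key2]
  ring
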